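/- (Solèr's Theorem, field identification.) Suppose the Hermitian form ⟨·,·⟩ is orthomodular and E contains an infinite orthonormal sequence e₁, e₂, …, i.e. ⟨eᵢ, eⱼ⟩ = 0 for i ≠ j and ⟨eᵢ, eᵢ⟩ = 1 for all i. Then K, with its involution, is isomorphic as a ring with involution to one of: the real numbers ℝ with the identity involution, the complex numbers ℂ with complex conjugation, or the real quaternions ℍ with quaternionic conjugation; that is, there exists a ring isomorphism φ from K onto ℝ, ℂ, or ℍ satisfying φ(ρ*) = φ(ρ)* for all ρ ∈ K. -/

import Mathlib

/-- A (nondegenerate) Hermitian space: a division ring `K` with an involution,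
a left `K`-vector space `E`, and a Hermitian form on `E`. -/
structure HermitianSpace (K E : Type*) [DivisionRing K] [AddCommGroup E] [Module K E] where
  star : K → K
  star_add : ∀ a b : K, star (a + b) = star a + star b
  star_mul : ∀ a b : K, star (a * b) = star b * star a
  star_star : ∀ a : K, star (star a) = a
  form : E → E → K
  form_add_left : ∀ x y z : E, form (x + y) z = form x z + form y z
  form_add_right : ∀ x y z : E, form x (y + z) = form x y + form x z
  form_smul_left : ∀ (ρ : K) (x y : E), form (ρ • x) y = ρ * form x y
  form_smul_right : ∀ (ρ : K) (x y : E), form x (ρ • y) = form x y * star ρ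
  nondeg : ∀ a : E, (∀ x : E, form a x = 0) → a = 0
  hermitian : ∀ x y : E, star (form x y) = form y x

namespace HermitianSpace

variable {K E : Type*} [DivisionRing K] [AddCommGroup E] [Module K E]

/-- The orthogonal companion `M^⊥` of a subspace `M`. -/
def perp (h : HermitianSpace K E) (M : Submodule K E) : Submodule K E where
  carrier := {x : E | ∀ m ∈ M, h.form x m = 0}
  add_mem' := fun {a b} ha hb => by
    intro m hm
    rw [h.form_add_left, ha m hm, hb m hm, add_zero]
  zero_mem' := by
    intro m hm
    have h0 : h.form ((0 : K) • (0 : E)) m = 0 * h.form 0 m := h.form_smul_left 0 0 m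
    simpa using h0
  smul_mem' := fun c a ha => by
    intro m hm
    rw [h.form_smul_left, ha m hm, mul_zero]

/-- The form is orthomodular when `M + M^⊥ = E` for every closed subspace `M`. -/
def Orthomodular (h : HermitianSpace K E) : Prop :=
  ∀ M : Submodule K E, h.perp (h.perp M) = M → M ⊔ h.perp M = ⊤

/-- The form is anisotropic when `⟨x, x⟩ ≠ 0` for every nonzero `x`. -/
def Anisotropic (h : HermitianSpace K E) : Prop :=
  ∀ x : E, x ≠ 0 → h.form x x ≠ 0

end HermitianSpace

/-- A cone of "norms" in a division ring with involution together with a notion of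
countable summability `HasTotal p s` (the sequence `p` of norms is summable with total `s`),
as provided by the sums of orthogonal vectors in an orthomodular space. -/
structure SummationCone (K : Type*) [DivisionRing K] [StarRing K] where
  Pos : K → Prop
  HasTotal : (ℕ → K) → K → Prop
  star_eq : ∀ {a}, Pos a → star a = a
  one : Pos 1
  add : ∀ {a b}, Pos a → Pos b → Pos (a + b)
  conj : ∀ {a} (r : K), Pos a → Pos (r * a * star r)
  eq_zero_of_add : ∀ {a b}, Pos a → Pos b → a + b = 0 → a = 0
  total_pos : ∀ {p s}, HasTotal p s → Pos s
  term_pos : ∀ {p s}, HasTotal p s → ∀ n, Pos (p n)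
  unique : ∀ {p s t}, HasTotal p s → HasTotal p t → s = t
  total_conj : ∀ {p s} {r : K}, r ≠ 0 → HasTotal p s →
    HasTotal (fun n => r * p n * star r) (r * s * star r)
  total_add : ∀ {p q s t}, HasTotal p s → HasTotal q t → HasTotal (fun n => p n + q n) (s + t)
  split : ∀ {p q s}, (∀ n, Pos (p n)) → (∀ n, Pos (q n)) → HasTotal (fun n => p n + q n) s →
    ∃ t u, s = t + u ∧ HasTotal p t ∧ HasTotal q u
  tail : ∀ {p s}, HasTotal p s → HasTotal (fun n => p (n + 1)) (s - p 0)
  geometric_or : ∀ {b : K}, star b = b → b ≠ 0 →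
    (∃ s, HasTotal (fun n => b ^ n * b ^ n) s) ∨
      HasTotal (fun n => ((∑ j ∈ Finset.range (n + 1), b ^ j * b ^ j) +
        (∑ j ∈ Finset.range (n + 1), b ^ j * b ^ j) * (b⁻¹ ^ (n + 1) * b⁻¹ ^ (n + 1)) *
          (∑ j ∈ Finset.range (n + 1), b ^ j * b ^ j))⁻¹) 1

namespace HermitianSpace

section Summation

variable {K E : Type*} [DivisionRing K] [AddCommGroup E] [Module K E] {ι : Type*}

theorem star_zero' (h : HermitianSpace K E) : h.star 0 = 0 := by
  simpa using h.star_add 0 0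

theorem star_neg' (h : HermitianSpace K E) (a : K) : h.star (-a) = -h.star a := by
  have := h.star_add a (-a)
  rw [add_neg_cancel, h.star_zero'] at this
  exact (neg_eq_of_add_eq_zero_right this.symm).symm

theorem star_one' (h : HermitianSpace K E) : h.star 1 = 1 := by
  have := h.star_mul 1 (h.star 1)
  rwa [h.star_star, one_mul, h.star_star, eq_comm] at this

theorem form_zero_left (h : HermitianSpace K E) (x : E) : h.form 0 x = 0 := by
  simpa using h.form_smul_left 0 0 x

theorem form_zero_right (h : HermitianSpace K E) (x : E) : h.form x 0 = 0 := by
  rw [← h.hermitian, form_zero_left, star_zero']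

theorem form_neg_left (h : HermitianSpace K E) (x y : E) : h.form (-x) y = -h.form x y := by
  simpa using h.form_smul_left (-1) x y

theorem form_neg_right (h : HermitianSpace K E) (x y : E) : h.form x (-y) = -h.form x y := by
  rw [← h.hermitian, form_neg_left, star_neg', h.hermitian]

theorem form_sub_left (h : HermitianSpace K E) (x y z : E) :
    h.form (x - y) z = h.form x z - h.form y z := by
  rw [sub_eq_add_neg, h.form_add_left, form_neg_left, sub_eq_add_neg]

theorem form_sub_right (h : HermitianSpace K E) (x y z : E) :
    h.form x (y - z) = h.form x y - h.form x z := by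
  rw [sub_eq_add_neg, h.form_add_right, form_neg_right, sub_eq_add_neg]

theorem form_swap (h : HermitianSpace K E) {x y : E} (hxy : h.form x y = 0) : h.form y x = 0 := by
  rw [← h.hermitian, hxy, star_zero']

theorem form_sum_left (h : HermitianSpace K E) (s : Finset ι) (v : ι → E) (x : E) :
    h.form (∑ i ∈ s, v i) x = ∑ i ∈ s, h.form (v i) x :=
  map_sum (⟨⟨fun y => h.form y x, h.form_zero_left x⟩, fun y z => h.form_add_left y z x⟩ : E →+ K)
    v s

theorem form_sum_right (h : HermitianSpace K E) (s : Finset ι) (v : ι → E) (x : E) :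
    h.form x (∑ i ∈ s, v i) = ∑ i ∈ s, h.form x (v i) :=
  map_sum (⟨⟨fun y => h.form x y, h.form_zero_right x⟩, fun y z => h.form_add_right x y z⟩ : E →+ K)
    v s

/-- `x` lies in the orthogonal closure `{vᵢ}^⊥⊥` of the family `v`. -/
def InClosure (h : HermitianSpace K E) (v : ι → E) (x : E) : Prop :=
  ∀ y, (∀ i, h.form y (v i) = 0) → h.form x y = 0

/-- `x` is the orthogonal sum of the family `v`: it lies in the closure of `v` and
has the components `vᵢ`. -/
def HasOrthoSum (h : HermitianSpace K E) (v : ι → E) (x : E) : Prop :=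
  (∀ i, h.form x (v i) = h.form (v i) (v i)) ∧ h.InClosure v x

/-- The members of `v` are pairwise orthogonal. -/
def IsOrtho (h : HermitianSpace K E) (v : ι → E) : Prop :=
  ∀ i j, i ≠ j → h.form (v i) (v j) = 0

theorem mem_perp_span (h : HermitianSpace K E) (v : ι → E) (x : E) :
    x ∈ h.perp (Submodule.span K (Set.range v)) ↔ ∀ i, h.form x (v i) = 0 := by
  constructor
  · intro hx i
    exact hx _ (Submodule.subset_span ⟨i, rfl⟩)
  · intro hx m hm
    induction hm using Submodule.span_induction with
    | mem y hy => obtain ⟨i, rfl⟩ := hy; exact hx i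
    | zero => exact h.form_zero_right x
    | add y z _ _ hy hz => rw [h.form_add_right, hy, hz, add_zero]
    | smul a y _ hy => rw [h.form_smul_right, hy, zero_mul]

theorem perp_perp_perp (h : HermitianSpace K E) (M : Submodule K E) :
    h.perp (h.perp (h.perp M)) = h.perp M := by
  apply le_antisymm
  · intro x hx m hm
    exact hx m fun y hy => h.form_swap (hy m hm)
  · intro x hx m hm
    exact h.form_swap (hm x hx)

theorem Orthomodular.exists_decomp {h : HermitianSpace K E} (hom : h.Orthomodular) (v : ι → E)
    (z : E) : ∃ m m', z = m + m' ∧ h.InClosure v m ∧ ∀ i, h.form m' (v i) = 0 := by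
  have key := hom (h.perp (h.perp (Submodule.span K (Set.range v)))) (h.perp_perp_perp _)
  rw [h.perp_perp_perp] at key
  obtain ⟨m, hm, m', hm', rfl⟩ := Submodule.mem_sup.1 (key ▸ Submodule.mem_top : z ∈ _ ⊔ _)
  exact ⟨m, m', rfl, fun y hy => hm y ((h.mem_perp_span v y).2 hy), (h.mem_perp_span v m').1 hm'⟩

theorem Orthomodular.eq_zero {h : HermitianSpace K E} (hom : h.Orthomodular) {x : E}
    (hx : h.form x x = 0) : x = 0 := by
  refine h.nondeg x fun z => ?_
  obtain ⟨m, m', rfl, hm, hm'⟩ := hom.exists_decomp (fun _ : Unit => x) z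
  exact h.form_swap (by rw [h.form_add_left, hm x fun _ => hx, hm' (), add_zero])

theorem InClosure.mono {h : HermitianSpace K E} {κ : Type*} {v : ι → E} {w : κ → E} {x : E}
    (hx : h.InClosure v x)
    (hvw : ∀ y, (∀ k, h.form y (w k) = 0) → ∀ i, h.form y (v i) = 0) : h.InClosure w x :=
  fun y hy => hx y (hvw y hy)

theorem InClosure.add {h : HermitianSpace K E} {v : ι → E} {x y : E}
    (hx : h.InClosure v x) (hy : h.InClosure v y) : h.InClosure v (x + y) := fun z hz => by
  rw [h.form_add_left, hx z hz, hy z hz, add_zero]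

theorem InClosure.smul {h : HermitianSpace K E} {v : ι → E} {x : E} (a : K)
    (hx : h.InClosure v x) : h.InClosure v (a • x) := fun z hz => by
  rw [h.form_smul_left, hx z hz, mul_zero]

theorem inClosure_self (h : HermitianSpace K E) (v : ι → E) (i : ι) : h.InClosure v (v i) :=
  fun _ hy => h.form_swap (hy i)

theorem InClosure.form_eq_zero {h : HermitianSpace K E} {κ : Type*} {v : ι → E} {w : κ → E}
    (hvw : ∀ i k, h.form (v i) (w k) = 0) {x y : E} (hx : h.InClosure v x)
    (hy : h.InClosure w y) : h.form x y = 0 :=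
  hx y fun i => hy (v i) (hvw i)

theorem HasOrthoSum.unique {h : HermitianSpace K E} (hom : h.Orthomodular) {v : ι → E} {x y : E}
    (hx : h.HasOrthoSum v x) (hy : h.HasOrthoSum v y) : x = y := by
  have h0 : ∀ i, h.form (x - y) (v i) = 0 := fun i => by
    rw [h.form_sub_left, hx.1, hy.1, sub_self]
  refine sub_eq_zero.1 (hom.eq_zero ?_)
  rw [h.form_sub_left, hx.2 _ h0, hy.2 _ h0, sub_self]

theorem HasOrthoSum.smul {h : HermitianSpace K E} {v : ι → E} {x : E} {a : K} (ha : a ≠ 0)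
    (hx : h.HasOrthoSum v x) : h.HasOrthoSum (fun i => a • v i) (a • x) := by
  refine ⟨fun i => ?_, fun y hy => ?_⟩
  · simp only [h.form_smul_left, h.form_smul_right, hx.1]
  · rw [h.form_smul_left, hx.2 y, mul_zero]
    intro i
    have := hy i
    rw [h.form_smul_right] at this
    refine (mul_eq_zero.1 this).resolve_right fun h0 => ha ?_
    rw [← h.star_star a, h0, h.star_zero']

/-- Splitting an orthogonal sum of two mutually orthogonal families. -/
theorem HasOrthoSum.split {h : HermitianSpace K E} (hom : h.Orthomodular) {f g : ι → E}
    (hf : h.IsOrtho f) (hg : h.IsOrtho g) (hfg : ∀ i j, h.form (f i) (g j) = 0) {x : E}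
    (hx : h.HasOrthoSum (fun i => f i + g i) x) :
    ∃ y z, x = y + z ∧ h.HasOrthoSum f y ∧ h.HasOrthoSum g z := by
  have hgf : ∀ i j, h.form (g i) (f j) = 0 := fun i j => h.form_swap (hfg j i)
  have hxi : ∀ i, h.form x (f i) = h.form (f i) (f i) ∧ h.form x (g i) = h.form (g i) (g i) := by
    intro i
    have h1 := hx.1 i
    simp only [h.form_add_left, h.form_add_right, hfg, hgf, add_zero, zero_add] at h1
    by_cases hgi : g i = 0
    · simpa [hgi, h.form_zero_right] using h1
    have hgi' : h.form (g i) (g i) ≠ 0 := fun h0 => hgi (hom.eq_zero h0)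
    set d := h.form (f i) (f i) * (h.form (g i) (g i))⁻¹ with hd
    have hdg : d * h.form (g i) (g i) = h.form (f i) (f i) := by
      rw [hd, mul_assoc, inv_mul_cancel₀ hgi', mul_one]
    have h2 : h.form (f i - d • g i) x = 0 := by
      refine h.form_swap (hx.2 _ fun j => ?_)
      simp only [h.form_sub_left, h.form_add_right, h.form_smul_left, hfg, hgf, add_zero,
        mul_zero, zero_add]
      by_cases hij : i = j
      · subst hij
        rw [hdg, sub_self]
      · rw [hf i j hij, hg i j hij, mul_zero, sub_zero]
    rw [h.form_sub_left, h.form_smul_left, sub_eq_zero] at h2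
    have h3 : h.form (f i) x + h.form (g i) x = h.form (f i) (f i) + h.form (g i) (g i) := by
      simpa only [h.star_add, h.hermitian] using congrArg h.star h1
    have h4 : (d + 1) * h.form (g i) x = (d + 1) * h.form (g i) (g i) := by
      rw [add_mul, add_mul, ← h2, hdg, one_mul, one_mul, h3]
    have h5 : d + 1 ≠ 0 := by
      intro h0
      have h6 : h.form (f i + g i) (f i + g i) = 0 := by
        simp only [h.form_add_left, h.form_add_right, hfg, hgf, add_zero, zero_add]
        rw [← hdg, ← add_one_mul, h0, zero_mul]
      have h7 := hom.eq_zero h6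
      apply hgi'
      rw [← h.form_zero_left (g i), ← h7, h.form_add_left, hfg, zero_add]
    have h8 := mul_left_cancel₀ h5 h4
    rw [h8] at h3
    have h9 := add_right_cancel h3
    refine ⟨?_, ?_⟩
    · rw [← h.hermitian, h9, h.hermitian]
    · rw [← h.hermitian, h8, h.hermitian]
  obtain ⟨m, m', rfl, hm, hm'⟩ := hom.exists_decomp f x
  have hmg : ∀ i, h.form m (g i) = 0 := fun i => hm _ (hgf i)
  refine ⟨m, m', rfl, ⟨fun i => ?_, hm⟩, ⟨fun i => ?_, fun y hy => ?_⟩⟩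
  · rw [← (hxi i).1, h.form_add_left, hm', add_zero]
  · rw [← (hxi i).2, h.form_add_left, hmg, zero_add]
  · obtain ⟨y₁, y₂, rfl, hy₁, hy₂⟩ := hom.exists_decomp f y
    have hyg : ∀ i, h.form y₂ (g i) = 0 := fun i => by
      have := hy i
      rwa [h.form_add_left, hy₁ _ (hgf i), zero_add] at this
    have h1 : h.form (m + m') y₂ = 0 := hx.2 _ fun i => by
      rw [h.form_add_right, hy₂, hyg, add_zero]
    rw [h.form_add_left, hm _ hy₂, zero_add] at h1
    rw [h.form_add_right, h1, h.form_swap (hy₁ _ hm'), add_zero]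

/-- Adding orthogonal sums of two mutually orthogonal families. -/
theorem HasOrthoSum.add {h : HermitianSpace K E} (hom : h.Orthomodular) {f g : ι → E}
    (hf : h.IsOrtho f) (hg : h.IsOrtho g) (hfg : ∀ i j, h.form (f i) (g j) = 0) {x y : E}
    (hx : h.HasOrthoSum f x) (hy : h.HasOrthoSum g y) :
    h.HasOrthoSum (fun i => f i + g i) (x + y) := by
  have hgf : ∀ i j, h.form (g i) (f j) = 0 := fun i j => h.form_swap (hfg j i)
  have hxg : ∀ i, h.form x (g i) = 0 := fun i => hx.2 _ (hgf i)
  have hyf : ∀ i, h.form y (f i) = 0 := fun i => hy.2 _ (hfg i)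
  have hxy : ∀ i, h.form (x + y) (f i + g i) = h.form (f i + g i) (f i + g i) := fun i => by
    simp only [h.form_add_left, h.form_add_right, hfg, hgf, hxg, hyf, hx.1, hy.1]
  obtain ⟨m, m', hmm, hm, hm'⟩ := hom.exists_decomp (fun i => f i + g i) (x + y)
  have hsum : h.HasOrthoSum (fun i => f i + g i) m := ⟨fun i => by
    rw [← hxy, hmm, h.form_add_left, hm', add_zero], hm⟩
  obtain ⟨x', y', rfl, hx', hy'⟩ := hsum.split hom hf hg hfg
  rwa [hx.unique hom hx', hy.unique hom hy']

theorem IsOrtho.neg {h : HermitianSpace K E} {f : ι → E} (hf : h.IsOrtho f) :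
    h.IsOrtho fun i => -f i := fun i j hij => by
  rw [h.form_neg_left, h.form_neg_right, hf i j hij, neg_zero, neg_zero]

theorem IsOrtho.add {h : HermitianSpace K E} {f g : ι → E} (hf : h.IsOrtho f) (hg : h.IsOrtho g)
    (hfg : ∀ i j, h.form (f i) (g j) = 0) : h.IsOrtho fun i => f i + g i := fun i j hij => by
  simp only [h.form_add_left, h.form_add_right, hf i j hij, hg i j hij, hfg,
    h.form_swap (hfg _ _), add_zero]

theorem IsOrtho.smul {h : HermitianSpace K E} {f : ι → E} (hf : h.IsOrtho f) (a : ι → K) :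
    h.IsOrtho fun i => a i • f i := fun i j hij => by
  rw [h.form_smul_left, h.form_smul_right, hf i j hij, zero_mul, mul_zero]

/-- Orthogonal summability and the norm of the sum only depend on the norms of the terms. -/
theorem HasOrthoSum.transfer {h : HermitianSpace K E} (hom : h.Orthomodular) (h2 : (2 : K) ≠ 0)
    {f g : ι → E} (hf : h.IsOrtho f) (hg : h.IsOrtho g) (hfg : ∀ i j, h.form (f i) (g j) = 0)
    (hn : ∀ i, h.form (f i) (f i) = h.form (g i) (g i)) {x : E} (hx : h.HasOrthoSum f x) :
    ∃ y, h.HasOrthoSum g y ∧ h.form y y = h.form x x := by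
  have hgf : ∀ i j, h.form (g i) (f j) = 0 := fun i j => h.form_swap (hfg j i)
  have hfg' : ∀ i j, h.form (f i) (-g j) = 0 := fun i j => by
    rw [h.form_neg_right, hfg, neg_zero]
  have huv : ∀ i j, h.form (f i + g i) (f j + -g j) = 0 := fun i j => by
    simp only [h.form_add_left, h.form_add_right, h.form_neg_right, hfg, hgf, neg_zero, add_zero,
      zero_add]
    by_cases hij : i = j
    · subst hij
      rw [hn, add_neg_cancel]
    · rw [hf i j hij, hg i j hij, neg_zero, add_zero]
  have hxx : h.HasOrthoSum (fun i => (f i + g i) + (f i + -g i)) ((2 : K) • x) := by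
    convert hx.smul h2 using 2 with i
    rw [two_smul]
    abel
  obtain ⟨m, m', hmm, hm, hm'⟩ := hxx.split hom (hf.add hg hfg) (hf.add hg.neg hfg') huv
  have hort : h.form m m' = 0 := hm.2.form_eq_zero huv hm'.2
  obtain ⟨x₁, y, rfl, hx₁, hy⟩ := hm.split hom hf hg hfg
  obtain ⟨x₂, y₂, rfl, hx₂, hy₂⟩ := hm'.split hom hf hg.neg hfg'
  obtain rfl := hx.unique hom hx₁
  obtain rfl := hx.unique hom hx₂
  have hy₂' : y₂ = -y := by
    rw [two_smul] at hmm
    have : y + y₂ = 0 := by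
      have h3 : x + x = x + x + (y + y₂) := by
        rw [add_add_add_comm, ← hmm]
      simpa using h3
    exact (neg_eq_of_add_eq_zero_right this).symm
  subst hy₂'
  refine ⟨y, hy, ?_⟩
  have hxy := hx.2.form_eq_zero hfg hy.2
  simp only [h.form_add_left, h.form_add_right, h.form_neg_right, hxy, h.form_swap hxy, neg_zero,
    add_zero, zero_add] at hort
  exact (eq_of_sub_eq_zero (by rw [sub_eq_add_neg, hort])).symm

theorem InClosure.hasOrthoSum {h : HermitianSpace K E} (hom : h.Orthomodular) {u : ι → E}
    (hu : h.IsOrtho u) (hu1 : ∀ i, h.form (u i) (u i) = 1) {x : E} (hx : h.InClosure u x) :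
    h.HasOrthoSum (fun i => h.form x (u i) • u i) x := by
  obtain ⟨m, m', rfl, hm, hm'⟩ := hom.exists_decomp (fun i => h.form x (u i) • u i) x
  set x := m + m' with hxm
  have hm'u : ∀ i, h.form m' (u i) = 0 := by
    intro i
    have h1 := hm' i
    rw [h.form_smul_right] at h1
    rcases mul_eq_zero.1 h1 with h1 | h1
    · exact h1
    have h2 : h.form x (u i) = 0 := by rw [← h.star_star (h.form x (u i)), h1, h.star_zero']
    have h3 : h.form m (u i) = 0 := hm _ fun j => by
      rw [h.form_smul_right]
      by_cases hij : i = j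
      · rw [← hij, h2, h.star_zero', mul_zero]
      · rw [hu i j hij, zero_mul]
    rwa [hxm, h.form_add_left, h3, zero_add] at h2
  have h0 : h.form m' m' = 0 := by
    have h1 := hx m' hm'u
    rwa [hxm, h.form_add_left, hm m' hm', zero_add] at h1
  have hmx : x = m := by rw [hxm, hom.eq_zero h0, add_zero]
  refine ⟨fun i => ?_, by rw [hmx] at hm ⊢; exact hm⟩
  simp only [h.form_smul_left, h.form_smul_right, hu1, one_mul]

theorem InClosure.transfer {h : HermitianSpace K E} (hom : h.Orthomodular) (h2 : (2 : K) ≠ 0)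
    {u w : ι → E} (hu : h.IsOrtho u) (hu1 : ∀ i, h.form (u i) (u i) = 1)
    (hw : h.IsOrtho w) (hw1 : ∀ i, h.form (w i) (w i) = 1) (huw : ∀ i j, h.form (u i) (w j) = 0)
    {x : E} (hx : h.InClosure u x) : ∃ y, h.InClosure w y ∧ h.form y y = h.form x x := by
  obtain ⟨y, hy, hyx⟩ := (hx.hasOrthoSum hom hu hu1).transfer hom h2
    (g := fun i => h.form x (u i) • w i) (hu.smul _) (hw.smul _)
    (fun i j => by rw [h.form_smul_left, h.form_smul_right, huw, zero_mul, mul_zero])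
    (fun i => by simp only [h.form_smul_left, h.form_smul_right, hu1, hw1])
  exact ⟨y, hy.2.mono fun z hz i => by rw [h.form_smul_right, hz, zero_mul], hyx⟩

end Summation

end HermitianSpace

namespace HermitianSpace

section Slots

variable {K E : Type*} [DivisionRing K] [AddCommGroup E] [Module K E]

/-- An orthonormal family with three indices in an orthomodular space. The closures of
the sequences `e c i` serve as mutually orthogonal slots, sorted into colours `c`. -/
structure IsSlotSystem (h : HermitianSpace K E) (e : ℕ → ℕ → ℕ → E) : Prop where
  orthomodular : h.Orthomodular
  two_ne_zero : (2 : K) ≠ 0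
  norm_one : ∀ c i j, h.form (e c i j) (e c i j) = 1
  ortho : ∀ c i j c' i' j', c ≠ c' ∨ i ≠ i' ∨ j ≠ j' → h.form (e c i j) (e c' i' j') = 0

/-- `a` is the norm of a vector in a slot. -/
def IsNorm (h : HermitianSpace K E) (e : ℕ → ℕ → ℕ → E) (a : K) : Prop :=
  ∃ x, h.InClosure (e 0 0) x ∧ h.form x x = a

/-- The norms `p` are those of a summable family of vectors in distinct slots, whose sum
has norm `s`. -/
def HasTotal (h : HermitianSpace K E) (e : ℕ → ℕ → ℕ → E) (p : ℕ → K) (s : K) : Prop :=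
  ∃ v : ℕ → E, (∀ i, h.InClosure (e 0 i) (v i)) ∧ (∀ i, h.form (v i) (v i) = p i) ∧
    ∃ x, h.HasOrthoSum v x ∧ h.form x x = s

variable {h : HermitianSpace K E} {e : ℕ → ℕ → ℕ → E}

namespace IsSlotSystem

theorem slot_ortho (he : h.IsSlotSystem e) {c i c' i' : ℕ} (hci : c ≠ c' ∨ i ≠ i') {x y : E}
    (hx : h.InClosure (e c i) x) (hy : h.InClosure (e c' i') y) : h.form x y = 0 :=
  hx.form_eq_zero (fun j k => he.ortho c i j c' i' k (by tauto)) hy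

theorem isOrtho_of_slots (he : h.IsSlotSystem e) {c : ℕ} {v : ℕ → E}
    (hv : ∀ i, h.InClosure (e c i) (v i)) : h.IsOrtho v :=
  fun i j hij => he.slot_ortho (Or.inr hij) (hv i) (hv j)

theorem exists_slot_of_ne (he : h.IsSlotSystem e) {c i c' i' : ℕ} (hci : c ≠ c' ∨ i ≠ i') {x : E}
    (hx : h.InClosure (e c i) x) : ∃ y, h.InClosure (e c' i') y ∧ h.form y y = h.form x x :=
  hx.transfer he.orthomodular he.two_ne_zero
    (fun j k hjk => he.ortho c i j c i k (by tauto)) (he.norm_one c i)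
    (fun j k hjk => he.ortho c' i' j c' i' k (by tauto)) (he.norm_one c' i')
    (fun j k => he.ortho c i j c' i' k (by tauto))

theorem exists_slot (he : h.IsSlotSystem e) {a : K} (ha : h.IsNorm e a) (c i : ℕ) :
    ∃ x, h.InClosure (e c i) x ∧ h.form x x = a := by
  obtain ⟨x, hx, rfl⟩ := ha
  by_cases hci : c = 0 ∧ i = 0
  · obtain ⟨rfl, rfl⟩ := hci
    exact ⟨x, hx, rfl⟩
  · exact he.exists_slot_of_ne (by tauto) hx

theorem isNorm_of_slot (he : h.IsSlotSystem e) {c i : ℕ} {x : E} (hx : h.InClosure (e c i) x) :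
    h.IsNorm e (h.form x x) := by
  by_cases hci : c = 0 ∧ i = 0
  · obtain ⟨rfl, rfl⟩ := hci
    exact ⟨x, hx, rfl⟩
  · exact he.exists_slot_of_ne (by tauto) hx

theorem isNorm_of_closure (he : h.IsSlotSystem e) {u : ℕ → E} (hu : h.IsOrtho u)
    (hu1 : ∀ i, h.form (u i) (u i) = 1) (hue : ∀ i j, h.form (u i) (e 2 0 j) = 0) {x : E}
    (hx : h.InClosure u x) : h.IsNorm e (h.form x x) := by
  obtain ⟨y, hy, hyx⟩ := hx.transfer he.orthomodular he.two_ne_zero hu hu1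
    (fun j k hjk => he.ortho 2 0 j 2 0 k (by tauto)) (he.norm_one 2 0) hue
  exact hyx ▸ he.isNorm_of_slot hy

theorem exists_slots (he : h.IsSlotSystem e) {p : ℕ → K} (hp : ∀ i, h.IsNorm e (p i)) (c : ℕ) :
    ∃ v : ℕ → E, (∀ i, h.InClosure (e c i) (v i)) ∧ ∀ i, h.form (v i) (v i) = p i := by
  choose v hv using fun i => he.exists_slot (hp i) c i
  exact ⟨v, fun i => (hv i).1, fun i => (hv i).2⟩

theorem isNorm_term (he : h.IsSlotSystem e) {p : ℕ → K} {s : K} (hp : h.HasTotal e p s) (i : ℕ) :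
    h.IsNorm e (p i) := by
  obtain ⟨v, hv, hvp, -⟩ := hp
  exact hvp i ▸ he.isNorm_of_slot (hv i)

theorem isNorm_total (he : h.IsSlotSystem e) {p : ℕ → K} {s : K} (hp : h.HasTotal e p s) :
    h.IsNorm e s := by
  obtain ⟨v, hv, -, x, hx, rfl⟩ := hp
  refine he.isNorm_of_closure (u := fun n => e 0 n.unpair.1 n.unpair.2) ?_
    (fun i => he.norm_one _ _ _) (fun i j => he.ortho _ _ _ _ _ _ (by simp)) (hx.2.mono ?_)
  · intro i j hij
    refine he.ortho _ _ _ _ _ _ (Or.inr ?_)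
    by_contra! hc
    apply hij
    rw [← Nat.pair_unpair i, ← Nat.pair_unpair j, hc.1, hc.2]
  · intro y hy i
    refine h.form_swap (hv i y fun k => ?_)
    simpa using hy (Nat.pair i k)

/-- A summable family with the norms of `p`, placed anywhere orthogonal to colour `0`, certifies
that `p` has a total. -/
theorem hasTotal_of_sum (he : h.IsSlotSystem e) {v : ℕ → E} (hv : h.IsOrtho v)
    (hve : ∀ i k j, h.form (v i) (e 0 k j) = 0) {p : ℕ → K} (hp : ∀ i, h.IsNorm e (p i))
    (hvp : ∀ i, h.form (v i) (v i) = p i) {x : E} (hx : h.HasOrthoSum v x) :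
    h.HasTotal e p (h.form x x) := by
  obtain ⟨w, hw, hwp⟩ := he.exists_slots hp 0
  obtain ⟨y, hy, hyx⟩ := hx.transfer he.orthomodular he.two_ne_zero hv (he.isOrtho_of_slots hw)
    (fun i j => h.form_swap (hw j _ fun k => hve i j k)) (fun i => by rw [hvp, hwp])
  exact ⟨w, hw, hwp, y, hy, hyx⟩

/-- If `p` has a total, then any orthogonal family with these norms, placed orthogonal to
colour `0`, is summable. -/
theorem sum_of_hasTotal (he : h.IsSlotSystem e) {p : ℕ → K} {s : K} (hp : h.HasTotal e p s)
    {v : ℕ → E} (hv : h.IsOrtho v) (hve : ∀ i k j, h.form (v i) (e 0 k j) = 0)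
    (hvp : ∀ i, h.form (v i) (v i) = p i) : ∃ x, h.HasOrthoSum v x ∧ h.form x x = s := by
  obtain ⟨w, hw, hwp, y, hy, rfl⟩ := hp
  exact hy.transfer he.orthomodular he.two_ne_zero (he.isOrtho_of_slots hw) hv
    (fun i j => hw i _ fun k => hve j i k) (fun i => by rw [hvp, hwp])

theorem slot_ortho_zero (he : h.IsSlotSystem e) {c i : ℕ} {x : E} (hx : h.InClosure (e c i) x)
    (hc : c ≠ 0) (k j : ℕ) : h.form x (e 0 k j) = 0 :=
  hx _ fun _ => he.ortho _ _ _ _ _ _ (Or.inl hc.symm)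

theorem hasTotal_unique (he : h.IsSlotSystem e) {p : ℕ → K} {s t : K} (hs : h.HasTotal e p s)
    (ht : h.HasTotal e p t) : s = t := by
  obtain ⟨v, hv, hvp⟩ := he.exists_slots (he.isNorm_term hs) 1
  have hv0 := fun i => he.slot_ortho_zero (hv i) one_ne_zero
  obtain ⟨x, hx, rfl⟩ := he.sum_of_hasTotal hs (he.isOrtho_of_slots hv) hv0 hvp
  obtain ⟨y, hy, rfl⟩ := he.sum_of_hasTotal ht (he.isOrtho_of_slots hv) hv0 hvp
  rw [hx.unique he.orthomodular hy]

theorem isNorm_add (he : h.IsSlotSystem e) {a b : K} (ha : h.IsNorm e a) (hb : h.IsNorm e b) :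
    h.IsNorm e (a + b) := by
  obtain ⟨x, hx, rfl⟩ := he.exists_slot ha 0 0
  obtain ⟨y, hy, rfl⟩ := he.exists_slot hb 0 1
  have hxy := he.slot_ortho (Or.inr zero_ne_one) hx hy
  have : h.form x x + h.form y y = h.form (x + y) (x + y) := by
    simp only [h.form_add_left, h.form_add_right, hxy, h.form_swap hxy, add_zero, zero_add]
  rw [this]
  refine he.isNorm_of_closure (u := fun n => e 0 n.unpair.1 n.unpair.2) ?_
    (fun i => he.norm_one _ _ _) (fun i j => he.ortho _ _ _ _ _ _ (by simp)) ?_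
  · intro i j hij
    refine he.ortho _ _ _ _ _ _ (Or.inr ?_)
    by_contra! hc
    apply hij
    rw [← Nat.pair_unpair i, ← Nat.pair_unpair j, hc.1, hc.2]
  · exact (hx.mono fun z hz i => by simpa using hz (Nat.pair 0 i)).add
      (hy.mono fun z hz i => by simpa using hz (Nat.pair 1 i))

theorem isNorm_conj (_he : h.IsSlotSystem e) {a : K} (r : K) (ha : h.IsNorm e a) :
    h.IsNorm e (r * a * h.star r) := by
  obtain ⟨x, hx, rfl⟩ := ha
  exact ⟨r • x, hx.smul r, by rw [h.form_smul_left, h.form_smul_right, mul_assoc]⟩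

theorem eq_zero_of_add (he : h.IsSlotSystem e) {a b : K} (ha : h.IsNorm e a) (hb : h.IsNorm e b)
    (hab : a + b = 0) : a = 0 := by
  obtain ⟨x, hx, rfl⟩ := he.exists_slot ha 0 0
  obtain ⟨y, hy, rfl⟩ := he.exists_slot hb 0 1
  have hxy := he.slot_ortho (Or.inr zero_ne_one) hx hy
  have h0 : h.form (x + y) (x + y) = 0 := by
    simpa only [h.form_add_left, h.form_add_right, hxy, h.form_swap hxy, add_zero, zero_add]
  have h1 : h.form (x + y) x = 0 := by rw [he.orthomodular.eq_zero h0, h.form_zero_left]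
  rwa [h.form_add_left, h.form_swap hxy, add_zero] at h1

theorem hasTotal_conj (_he : h.IsSlotSystem e) {p : ℕ → K} {s r : K} (hr : r ≠ 0)
    (hp : h.HasTotal e p s) :
    h.HasTotal e (fun n => r * p n * h.star r) (r * s * h.star r) := by
  obtain ⟨v, hv, hvp, x, hx, rfl⟩ := hp
  refine ⟨fun i => r • v i, fun i => (hv i).smul r, fun i => ?_, r • x, hx.smul hr, ?_⟩
  · simp only [h.form_smul_left, h.form_smul_right, hvp, mul_assoc]
  · rw [h.form_smul_left, h.form_smul_right, mul_assoc]

theorem hasTotal_add (he : h.IsSlotSystem e) {p q : ℕ → K} {s t : K} (hp : h.HasTotal e p s)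
    (hq : h.HasTotal e q t) : h.HasTotal e (fun n => p n + q n) (s + t) := by
  obtain ⟨v, hv, hvp⟩ := he.exists_slots (he.isNorm_term hp) 1
  obtain ⟨w, hw, hwq⟩ := he.exists_slots (he.isNorm_term hq) 2
  have hv0 := fun i => he.slot_ortho_zero (hv i) one_ne_zero
  have hw0 := fun i => he.slot_ortho_zero (hw i) (by decide)
  have hvo := he.isOrtho_of_slots hv
  have hwo := he.isOrtho_of_slots hw
  have hvw : ∀ i j, h.form (v i) (w j) = 0 := fun i j =>
    he.slot_ortho (Or.inl (by decide)) (hv i) (hw j)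
  obtain ⟨x, hx, rfl⟩ := he.sum_of_hasTotal hp hvo hv0 hvp
  obtain ⟨y, hy, rfl⟩ := he.sum_of_hasTotal hq hwo hw0 hwq
  have hxy := hx.2.form_eq_zero hvw hy.2
  have := he.hasTotal_of_sum (hvo.add hwo hvw)
    (fun i k j => by rw [h.form_add_left, hv0, hw0, add_zero])
    (fun i => he.isNorm_add (he.isNorm_term hp i) (he.isNorm_term hq i))
    (fun i => by simp only [h.form_add_left, h.form_add_right, hvw, h.form_swap (hvw _ _), hvp,
      hwq, add_zero, zero_add])
    (hx.add he.orthomodular hvo hwo hvw hy)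
  simpa only [h.form_add_left, h.form_add_right, hxy, h.form_swap hxy, add_zero, zero_add]
    using this

theorem hasTotal_split (he : h.IsSlotSystem e) {p q : ℕ → K} {s : K}
    (hp : ∀ n, h.IsNorm e (p n)) (hq : ∀ n, h.IsNorm e (q n))
    (hs : h.HasTotal e (fun n => p n + q n) s) :
    ∃ t u, s = t + u ∧ h.HasTotal e p t ∧ h.HasTotal e q u := by
  obtain ⟨v, hv, hvp⟩ := he.exists_slots hp 1
  obtain ⟨w, hw, hwq⟩ := he.exists_slots hq 2
  have hv0 := fun i => he.slot_ortho_zero (hv i) one_ne_zero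
  have hw0 := fun i => he.slot_ortho_zero (hw i) (by decide)
  have hvo := he.isOrtho_of_slots hv
  have hwo := he.isOrtho_of_slots hw
  have hvw : ∀ i j, h.form (v i) (w j) = 0 := fun i j =>
    he.slot_ortho (Or.inl (by decide)) (hv i) (hw j)
  obtain ⟨x, hx, rfl⟩ := he.sum_of_hasTotal hs (hvo.add hwo hvw)
    (fun i k j => by rw [h.form_add_left, hv0, hw0, add_zero])
    (fun i => by simp only [h.form_add_left, h.form_add_right, hvw, h.form_swap (hvw _ _), hvp,
      hwq, add_zero, zero_add])
  obtain ⟨y, z, rfl, hy, hz⟩ := hx.split he.orthomodular hvo hwo hvw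
  have hyz := hy.2.form_eq_zero hvw hz.2
  refine ⟨h.form y y, h.form z z, ?_, he.hasTotal_of_sum hvo hv0 hp hvp hy,
    he.hasTotal_of_sum hwo hw0 hq hwq hz⟩
  simp only [h.form_add_left, h.form_add_right, hyz, h.form_swap hyz, add_zero, zero_add]

theorem hasTotal_tail (he : h.IsSlotSystem e) {p : ℕ → K} {s : K} (hs : h.HasTotal e p s) :
    h.HasTotal e (fun n => p (n + 1)) (s - p 0) := by
  obtain ⟨v, hv, hvp⟩ := he.exists_slots (he.isNorm_term hs) 1
  have hvo := he.isOrtho_of_slots hv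
  obtain ⟨x, hx, rfl⟩ := he.sum_of_hasTotal hs hvo
    (fun i => he.slot_ortho_zero (hv i) one_ne_zero) hvp
  have hx0 : h.form x (v 0) = p 0 := by rw [hx.1, hvp]
  have hx0' : h.form (v 0) x = p 0 := by rw [← h.hermitian, hx.1, h.hermitian, hvp]
  have hn : h.form (x - v 0) (x - v 0) = h.form x x - p 0 := by
    simp only [h.form_sub_left, h.form_sub_right, hx0, hx0', hvp]
    abel
  rw [← hn]
  refine he.hasTotal_of_sum (v := fun n => v (n + 1)) (fun i j hij => hvo _ _ (by omega))
    (fun i => he.slot_ortho_zero (hv _) one_ne_zero) (fun i => he.isNorm_term hs _)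
    (fun i => hvp _) ⟨fun i => ?_, fun y hy => ?_⟩
  · rw [h.form_sub_left, hx.1, hvo 0 (i + 1) (by omega), sub_zero]
  · by_cases hv00 : v 0 = 0
    · rw [hv00, sub_zero]
      refine hx.2 y fun i => ?_
      rcases i with _ | i
      · rw [hv00, h.form_zero_right]
      · exact hy i
    have hp0 : p 0 ≠ 0 := fun h0 => hv00 (he.orthomodular.eq_zero (by rw [hvp, h0]))
    set d := h.form y (v 0) * (p 0)⁻¹ with hd
    have hd' : h.form y (v 0) = d * p 0 := by rw [hd, mul_assoc, inv_mul_cancel₀ hp0, mul_one]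
    have h1 : h.form x (y - d • v 0) = 0 := by
      refine hx.2 _ fun i => ?_
      rw [h.form_sub_left, h.form_smul_left]
      rcases i with _ | i
      · rw [hvp, hd', sub_self]
      · rw [hy, hvo 0 (i + 1) (by omega), mul_zero, sub_zero]
    have h2 : h.form (y - d • v 0) x = 0 := h.form_swap h1
    rw [h.form_sub_left, h.form_smul_left, hx0', sub_eq_zero] at h2
    refine h.form_swap ?_
    rw [h.form_sub_right, h2, hd', sub_self]

theorem _root_.HermitianSpace.star_inv' (h : HermitianSpace K E) (a : K) :
    h.star a⁻¹ = (h.star a)⁻¹ := by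
  by_cases ha : a = 0
  · simp [ha, h.star_zero']
  · refine eq_inv_of_mul_eq_one_left ?_
    rw [← h.star_mul, mul_inv_cancel₀ ha, h.star_one']

theorem _root_.HermitianSpace.star_pow' (h : HermitianSpace K E) {b : K} (hb : h.star b = b)
    (n : ℕ) : h.star (b ^ n) = b ^ n := by
  induction n with
  | zero => simp [h.star_one']
  | succ n ih => rw [pow_succ, h.star_mul, ih, hb, ← pow_succ, ← pow_succ']

theorem geometric_or (he : h.IsSlotSystem e) {b : K} (hb : h.star b = b) (hb0 : b ≠ 0) :
    (∃ s, h.HasTotal e (fun n => b ^ n * b ^ n) s) ∨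
      h.HasTotal e (fun n => ((∑ j ∈ Finset.range (n + 1), b ^ j * b ^ j) +
        (∑ j ∈ Finset.range (n + 1), b ^ j * b ^ j) * (b⁻¹ ^ (n + 1) * b⁻¹ ^ (n + 1)) *
          (∑ j ∈ Finset.range (n + 1), b ^ j * b ^ j))⁻¹) 1 := by
  rw [or_iff_not_imp_left]
  intro hno
  set ε : ℕ → E := fun n => e 1 n 0 with hε
  have hε1 : ∀ i, h.form (ε i) (ε i) = 1 := fun i => he.norm_one _ _ _
  have hεo : h.IsOrtho ε := fun i j hij => he.ortho _ _ _ _ _ _ (by tauto)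
  have hεe : ∀ c i k j, c ≠ 1 → h.form (ε i) (e c k j) = 0 := fun c i k j hc =>
    he.ortho _ _ _ _ _ _ (Or.inl hc.symm)
  set s : ℕ → K := fun n => ∑ j ∈ Finset.range (n + 1), b ^ j * b ^ j with hs
  set c : ℕ → K := fun n => b⁻¹ ^ (n + 1) with hc
  have hcb : ∀ n, c n * b ^ (n + 1) = 1 := fun n => by
    rw [hc]
    simp only [inv_pow]
    exact inv_mul_cancel₀ (pow_ne_zero _ hb0)
  have hbc : ∀ n, b ^ (n + 1) * c n = 1 := fun n => by
    rw [hc]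
    simp only [inv_pow]
    exact mul_inv_cancel₀ (pow_ne_zero _ hb0)
  have hcstar : ∀ n, h.star (c n) = c n := fun n =>
    h.star_pow' (by rw [h.star_inv', hb]) _
  set F : ℕ → E := fun m => ∑ j ∈ Finset.range m, b ^ j • ε j with hF
  have hFε : ∀ m k, k < m → h.form (F m) (ε k) = b ^ k := fun m k hk => by
    rw [hF, h.form_sum_left, Finset.sum_eq_single_of_mem k (Finset.mem_range.2 hk)]
    · rw [h.form_smul_left, hε1, mul_one]
    · intro j _ hjk
      rw [h.form_smul_left, hεo j k hjk, mul_zero]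
  have hFε' : ∀ m k, m ≤ k → h.form (F m) (ε k) = 0 := fun m k hk => by
    rw [hF, h.form_sum_left]
    refine Finset.sum_eq_zero fun j hj => ?_
    rw [h.form_smul_left, hεo j k (by have := Finset.mem_range.1 hj; omega), mul_zero]
  have hyF : ∀ (y : E) (n : ℕ), h.form y (F (n + 1)) =
      ∑ j ∈ Finset.range (n + 1), h.form y (ε j) * b ^ j := fun y n => by
    rw [hF, h.form_sum_right]
    exact Finset.sum_congr rfl fun j _ => by rw [h.form_smul_right, h.star_pow' hb]
  have hFF : ∀ n m, n ≤ m → h.form (F (m + 1)) (F (n + 1)) = s n := fun n m hnm => by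
    rw [hyF, hs]
    refine Finset.sum_congr rfl fun j hj => ?_
    rw [hFε _ _ (by have := Finset.mem_range.1 hj; omega)]
  have hsstar : ∀ n, h.star (s n) = s n := fun n => by
    rw [← hFF n n le_rfl, h.hermitian]
  set f : ℕ → E := fun n => F (n + 1) - (s n * c n) • ε (n + 1) with hf
  have htstar : ∀ n, h.star (s n * c n) = c n * s n := fun n => by
    rw [h.star_mul, hcstar, hsstar]
  have hyf : ∀ y n, h.form y (f n) = h.form y (F (n + 1)) - h.form y (ε (n + 1)) * (c n * s n) :=
    fun y n => by rw [hf, h.form_sub_right, h.form_smul_right, htstar]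
  have hfo' : ∀ n m, n < m → h.form (f m) (f n) = 0 := fun n m hnm => by
    rw [hyf, hf]
    simp only [h.form_sub_left, h.form_smul_left]
    rw [hFF n m hnm.le, hFε _ _ (by omega), hεo _ _ (by omega), hyF,
      Finset.sum_eq_zero fun j hj => ?_, ← mul_assoc]
    · simp [hbc]
    · rw [hεo _ _ (by have := Finset.mem_range.1 hj; omega), zero_mul]
  have hfo : h.IsOrtho f := fun n m hnm => by
    rcases lt_or_gt_of_ne hnm with hlt | hlt
    · exact h.form_swap (hfo' _ _ hlt)
    · exact hfo' _ _ hlt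
  have hff : ∀ n, h.form (f n) (f n) = s n + s n * (c n * c n) * s n := fun n => by
    rw [hyf, hf]
    simp only [h.form_sub_left, h.form_smul_left]
    rw [hFF n n le_rfl, hFε' _ _ le_rfl, hε1, hyF, Finset.sum_eq_zero fun j hj => ?_]
    · simp [mul_assoc]
    · rw [hεo _ _ (by have := Finset.mem_range.1 hj; omega), zero_mul]
  have hεf : ∀ n, h.form (ε 0) (f n) = 1 := fun n => by
    rw [hyf, hεo 0 (n + 1) (by omega), zero_mul, sub_zero, ← h.hermitian, hFε _ _ (by omega),
      pow_zero, h.star_one']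
  have hN : ∀ n, h.form (f n) (f n) ≠ 0 := fun n h0 => by
    have := hεf n
    rw [he.orthomodular.eq_zero h0, h.form_zero_right] at this
    exact zero_ne_one this
  have hs0 : ∀ n, s n ≠ 0 := fun n h0 => hN n (by rw [hff, h0]; simp)
  set N : ℕ → K := fun n => h.form (f n) (f n) with hNdef
  have hNstar : ∀ n, h.star (N n)⁻¹ = (N n)⁻¹ := fun n => by
    rw [h.star_inv', hNdef, h.hermitian]
  set g : ℕ → E := fun n => (N n)⁻¹ • f n with hg
  have hgg : ∀ n, h.form (g n) (g n) = (N n)⁻¹ := fun n => by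
    rw [hg]
    simp only [h.form_smul_left, h.form_smul_right, hNstar]
    rw [← mul_assoc, inv_mul_cancel₀ (hN n), one_mul]
  have hgcl : ∀ n, h.InClosure ε (g n) := fun n y hy => by
    have : h.form y (g n) = 0 := by
      rw [hg, h.form_smul_right, hyf, hy, hyF, Finset.sum_eq_zero fun j hj => ?_]
      · simp
      · rw [hy, zero_mul]
    exact h.form_swap this
  have hsum : h.HasOrthoSum g (ε 0) := by
    refine ⟨fun n => ?_, fun y hy => h.form_swap ?_⟩
    · rw [hgg, hg, h.form_smul_right, hεf, one_mul, hNstar]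
    by_contra hβ
    apply hno
    set z := (h.form y (ε 0))⁻¹ • y with hz
    have hzf : ∀ n, h.form z (f n) = 0 := fun n => by
      have := hy n
      rw [hg, h.form_smul_right, hNstar] at this
      rw [hz, h.form_smul_left, (mul_eq_zero.1 this).resolve_right (inv_ne_zero (hN n)), mul_zero]
    have hzε : ∀ n, h.form z (ε n) = b ^ n := by
      intro n
      induction n using Nat.strong_induction_on with
      | _ n ih =>
        rcases n with _ | n
        · rw [hz, h.form_smul_left, inv_mul_cancel₀ hβ, pow_zero]
        · have h1 := hzf n
          have h2 : h.form z (F (n + 1)) = s n := by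
            rw [hyF]
            exact Finset.sum_congr rfl fun j hj => by rw [ih j (Finset.mem_range.1 hj)]
          rw [hyf, h2, ← mul_assoc, sub_eq_zero, eq_comm] at h1
          have h3 := (mul_eq_right₀ (hs0 n)).1 h1
          calc h.form z (ε (n + 1)) = h.form z (ε (n + 1)) * (c n * b ^ (n + 1)) := by
                rw [hcb, mul_one]
            _ = b ^ (n + 1) := by rw [← mul_assoc, h3, one_mul]
    obtain ⟨m, m', hmm, hm, hm'⟩ := he.orthomodular.exists_decomp (fun n => b ^ n • ε n) z
    have hvv : ∀ n, h.form (b ^ n • ε n) (b ^ n • ε n) = b ^ n * b ^ n := fun n => by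
      rw [h.form_smul_left, h.form_smul_right, hε1, one_mul, h.star_pow' hb]
    refine ⟨h.form m m, he.hasTotal_of_sum (hεo.smul _)
      (fun i k j => by rw [h.form_smul_left, hεe 0 i k j (by decide), mul_zero])
      (fun i => ?_) hvv ⟨fun i => ?_, hm⟩⟩
    · rw [← hvv]
      exact he.isNorm_of_slot ((h.inClosure_self (e 1 i) 0).smul _)
    · rw [hvv]
      have h4 := congrArg (fun w => h.form w (b ^ i • ε i)) hmm
      simp only [h.form_add_left, hm', add_zero] at h4
      rw [← h4, h.form_smul_right, hzε, h.star_pow' hb]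
  have hfin := he.hasTotal_of_sum (hfo.smul _)
    (fun i k j => hgcl i _ fun l => h.form_swap (hεe 0 l k j (by decide)))
    (fun i => hgg i ▸ he.isNorm_of_closure hεo hε1 (fun i j => hεe 2 i 0 j (by decide)) (hgcl i))
    hgg hsum
  rw [hε1] at hfin
  convert hfin using 3 with n
  exact (hff n).symm

/-- The star ring structure on the coefficient division ring of a Hermitian space. -/
abbrev _root_.HermitianSpace.starRing (h : HermitianSpace K E) : StarRing K where
  star := h.star
  star_involutive := h.star_star
  star_mul := h.star_mul
  star_add := h.star_add

theorem isNorm_one (he : h.IsSlotSystem e) : h.IsNorm e 1 :=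
  ⟨e 0 0 0, h.inClosure_self _ 0, he.norm_one 0 0 0⟩

theorem star_of_isNorm (_he : h.IsSlotSystem e) {a : K} (ha : h.IsNorm e a) : h.star a = a := by
  obtain ⟨x, -, rfl⟩ := ha
  exact h.hermitian x x

/-- The summation cone of an orthomodular space with an orthonormal sequence. -/
def cone (he : h.IsSlotSystem e) : @SummationCone K _ h.starRing :=
  letI := h.starRing
  { Pos := h.IsNorm e
    HasTotal := h.HasTotal e
    star_eq := he.star_of_isNorm
    one := he.isNorm_one
    add := he.isNorm_add
    conj := he.isNorm_conj
    eq_zero_of_add := he.eq_zero_of_add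
    total_pos := he.isNorm_total
    term_pos := he.isNorm_term
    unique := he.hasTotal_unique
    total_conj := he.hasTotal_conj
    total_add := he.hasTotal_add
    split := he.hasTotal_split
    tail := he.hasTotal_tail
    geometric_or := he.geometric_or }

end IsSlotSystem

theorem Orthomodular.isSlotSystem {h : HermitianSpace K E} (hom : h.Orthomodular) {e : ℕ → E}
    (horth : ∀ i j : ℕ, i ≠ j → h.form (e i) (e j) = 0) (hnorm : ∀ i : ℕ, h.form (e i) (e i) = 1) :
    h.IsSlotSystem fun c i j => e (Nat.pair c (Nat.pair i j)) where
  orthomodular := hom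
  two_ne_zero h2 := by
    have h0 : h.form (e 0 + e 1) (e 0 + e 1) = 0 := by
      simp only [h.form_add_left, h.form_add_right, horth 0 1 (by decide), horth 1 0 (by decide),
        hnorm, add_zero, zero_add, one_add_one_eq_two, h2]
    have h1 : h.form (e 0 + e 1) (e 0) = 1 := by
      rw [h.form_add_left, horth 1 0 (by decide), hnorm, add_zero]
    rw [hom.eq_zero h0, h.form_zero_left] at h1
    exact zero_ne_one h1
  norm_one _ _ _ := hnorm _
  ortho c i j c' i' j' hne := horth _ _ fun heq => by
    rw [Nat.pair_eq_pair, Nat.pair_eq_pair] at heq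
    tauto

end Slots

end HermitianSpace

namespace SummationCone

section Basic

variable {K : Type*} [DivisionRing K] [StarRing K] (C : SummationCone K)

theorem zero : C.Pos 0 := by
  simpa using C.conj 0 C.one

theorem mul_star_self (r : K) : C.Pos (r * star r) := by
  simpa using C.conj r C.one

theorem mul_self {r : K} (hr : star r = r) : C.Pos (r * r) := by
  simpa [hr] using C.mul_star_self r

variable {C}

theorem eq_zero_of_neg {a : K} (h : C.Pos a) (h2 : C.Pos (-a)) : a = 0 :=
  C.eq_zero_of_add h h2 (add_neg_cancel a)

theorem one_add_ne_zero {a : K} (h : C.Pos a) : 1 + a ≠ 0 := fun h0 =>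
  one_ne_zero (C.eq_zero_of_add C.one h h0)

theorem inv {a : K} (h : C.Pos a) : C.Pos a⁻¹ := by
  rcases eq_or_ne a 0 with rfl | ha
  · simpa using h
  · simpa [ha, C.star_eq h] using C.conj a⁻¹ h

variable (C)

theorem natCast (n : ℕ) : C.Pos (n : K) := by
  induction n with
  | zero => simpa using C.zero
  | succ n ih => simpa using C.add ih C.one

theorem charZero (C : SummationCone K) : CharZero K :=
  charZero_of_inj_zero fun n hn => by
    cases n with
    | zero => rfl
    | succ n =>
      rw [Nat.cast_succ, add_comm] at hn
      exact absurd hn (one_add_ne_zero (C.natCast n))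

variable {C}

theorem natCast_mul {a : K} (h : C.Pos a) (n : ℕ) : C.Pos (n * a) := by
  induction n with
  | zero => simpa using C.zero
  | succ n ih => simpa [add_mul] using C.add ih h

theorem smul {q : ℚ} (hq : 0 ≤ q) {a : K} (h : C.Pos a) : C.Pos ((q : K) * a) := by
  have := C.charZero
  have h1 : C.Pos ((q.num.toNat * q.den : ℕ) * a) := natCast_mul h _
  have h2 := C.conj ((q.den : K)⁻¹) h1
  have hn : ((q.num.toNat : ℕ) : ℚ) = q.num := by
    exact_mod_cast Int.toNat_of_nonneg (Rat.num_nonneg.2 hq)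
  have h3 : (q : K) = (q.num.toNat : K) * (q.den : K)⁻¹ := by
    have : q = (q.num.toNat : ℚ) * (q.den : ℚ)⁻¹ := by
      rw [hn, ← div_eq_mul_inv, Rat.num_div_den]
    conv_lhs => rw [this]
    push_cast
    rfl
  have hd : (q.den : K) ≠ 0 := by exact_mod_cast q.den_nz
  convert h2 using 1
  rw [h3, star_inv₀, star_natCast]
  have c1 : (q.den : K)⁻¹ * a = a * (q.den : K)⁻¹ := ((Nat.cast_commute q.den a).inv_left₀).eq
  have c2 : (q.den : K)⁻¹ * (q.num.toNat : K) = (q.num.toNat : K) * (q.den : K)⁻¹ :=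
    (Nat.cast_commute q.num.toNat _).eq.symm
  rw [Nat.cast_mul]
  calc _ = (q.num.toNat : K) * ((q.den : K)⁻¹ * a) := by rw [mul_assoc]
    _ = (q.num.toNat : K) * (a * (q.den : K)⁻¹) := by rw [c1]
    _ = (q.num.toNat : K) * ((q.den : K)⁻¹ * (q.den : K)) * (a * (q.den : K)⁻¹) := by
      rw [inv_mul_cancel₀ hd, mul_one]
    _ = ((q.num.toNat : K) * (q.den : K)⁻¹) * (q.den : K) * (a * (q.den : K)⁻¹) := by
      simp only [mul_assoc]
    _ = _ := by rw [← c2]; simp only [mul_assoc]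

theorem total_congr {p q : ℕ → K} {s : K} (h : C.HasTotal p s) (hpq : ∀ n, p n = q n) :
    C.HasTotal q s :=
  (funext hpq : p = q) ▸ h

theorem eq_zero_of_const {p s : K} (h : C.HasTotal (fun _ => p) s) : p = 0 := by
  have := C.unique (C.tail h) h
  simpa using this

theorem tail_add {p : ℕ → K} {s : K} (h : C.HasTotal p s) (n : ℕ) :
    C.HasTotal (fun m => p (m + n)) (s - ∑ j ∈ Finset.range n, p j) := by
  induction n with
  | zero => simpa using h
  | succ n ih =>
    have := C.tail ih
    rw [Finset.sum_range_succ, ← sub_sub]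
    refine total_congr (by simpa using this) fun m => by congr 1; ring

theorem sub_sum {p : ℕ → K} {s : K} (h : C.HasTotal p s) (n : ℕ) :
    C.Pos (s - ∑ j ∈ Finset.range n, p j) :=
  C.total_pos (tail_add h n)

end Basic

section DivisionRing

variable {K : Type*} [DivisionRing K] {b : K}

theorem sum_inv_geometric (hb0 : b ≠ 0) (n : ℕ) :
    (∑ j ∈ Finset.range (n + 1), b⁻¹ ^ j * b⁻¹ ^ j) =
      b⁻¹ ^ n * b⁻¹ ^ n * ∑ j ∈ Finset.range (n + 1), b ^ j * b ^ j := by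
  rw [← Finset.sum_range_reflect, Finset.mul_sum]
  refine Finset.sum_congr rfl fun j hj => ?_
  have hj : j ≤ n := Nat.lt_succ_iff.1 (Finset.mem_range.1 hj)
  have e : b⁻¹ ^ n = b⁻¹ ^ (n - j) * (b⁻¹) ^ j := by rw [← pow_add, Nat.sub_add_cancel hj]
  have e1 : b⁻¹ ^ j * b ^ j = 1 := by rw [inv_pow]; exact inv_mul_cancel₀ (pow_ne_zero j hb0)
  have c1 : b⁻¹ ^ (n - j) * b⁻¹ ^ j = b⁻¹ ^ j * b⁻¹ ^ (n - j) := (Commute.pow_pow_self _ _ _).eq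
  have e2 (X Y B : K) : X * Y * (X * Y) * (B * B) = X * (Y * X) * (Y * B) * B := by
    simp only [mul_assoc]
  rw [show n + 1 - 1 - j = n - j by omega, e, e2, e1, mul_one, ← c1, mul_assoc, mul_assoc, e1,
    mul_one]

theorem geometric_inv_partial (hb0 : b ≠ 0) (n : ℕ) :
    (∑ j ∈ Finset.range (n + 1), b⁻¹ ^ j * b⁻¹ ^ j) +
        (∑ j ∈ Finset.range (n + 1), b⁻¹ ^ j * b⁻¹ ^ j) * (b ^ (n + 1) * b ^ (n + 1)) *
          (∑ j ∈ Finset.range (n + 1), b⁻¹ ^ j * b⁻¹ ^ j) =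
    b * ((∑ j ∈ Finset.range (n + 1), b ^ j * b ^ j) +
        (∑ j ∈ Finset.range (n + 1), b ^ j * b ^ j) * (b⁻¹ ^ (n + 1) * b⁻¹ ^ (n + 1)) *
          (∑ j ∈ Finset.range (n + 1), b ^ j * b ^ j)) * b := by
  rw [sum_inv_geometric hb0]
  set S := ∑ j ∈ Finset.range (n + 1), b ^ j * b ^ j with hS
  have hbS : Commute b S := Commute.sum_right _ _ _ fun j _ =>
    ((Commute.refl b).pow_right j).mul_right ((Commute.refl b).pow_right j)
  set G := b⁻¹ ^ n * b⁻¹ ^ n with hG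
  have hbG : Commute b G :=
    ((Commute.refl b).inv_right₀.pow_right n).mul_right ((Commute.refl b).inv_right₀.pow_right n)
  have hSG : Commute S G :=
    (hbS.symm.inv_right₀.pow_right n).mul_right (hbS.symm.inv_right₀.pow_right n)
  have e1 : b⁻¹ ^ n * b ^ n = 1 := by rw [inv_pow]; exact inv_mul_cancel₀ (pow_ne_zero n hb0)
  have hGP : G * (b ^ n * b ^ n) = 1 := by
    rw [hG, mul_assoc, ← mul_assoc (b⁻¹ ^ n) (b ^ n), e1, one_mul, e1]
  have hGb : b * (b⁻¹ ^ (n + 1) * b⁻¹ ^ (n + 1)) * b = G := by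
    rw [← mul_assoc, mul_assoc, pow_succ, mul_assoc _ b⁻¹ b, inv_mul_cancel₀ hb0, mul_one,
      ← pow_succ, pow_succ', mul_inv_cancel_left₀ hb0]
  have hPb : b ^ (n + 1) * b ^ (n + 1) = b * (b ^ n * b ^ n) * b := by
    rw [pow_succ' b n]
    nth_rewrite 2 [← pow_succ']
    rw [pow_succ]
    simp only [mul_assoc]
  have hrec : 1 + b * S * b = S + b * (b ^ n * b ^ n) * b := by
    have h1 : ∑ j ∈ Finset.range (n + 2), b ^ j * b ^ j = S + b * (b ^ n * b ^ n) * b := by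
      rw [Finset.sum_range_succ, ← hPb]
    have h2 : ∑ j ∈ Finset.range (n + 2), b ^ j * b ^ j = 1 + b * S * b := by
      rw [Finset.sum_range_succ', hS, Finset.mul_sum, Finset.sum_mul, add_comm]
      congr 1
      · simp
      · refine Finset.sum_congr rfl fun j _ => ?_
        rw [← mul_assoc, ← pow_succ', mul_assoc, ← pow_succ]
    rw [← h1, h2]
  have h1 : b * (S * (b⁻¹ ^ (n + 1) * b⁻¹ ^ (n + 1)) * S) * b = G * S * S := by
    rw [← hSG.eq, ← hGb]
    simp only [← mul_assoc]
    rw [hbS.eq]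
    simp only [mul_assoc]
    rw [hbS.eq]
  have h2 : G * S * (b * (b ^ n * b ^ n) * b) * (G * S) = b * (G * S * S) * b := by
    rw [← hSG.eq]
    calc _ = S * (G * b) * (b ^ n * b ^ n) * b * (S * G) := by simp only [mul_assoc]
      _ = (S * b) * (G * (b ^ n * b ^ n)) * (b * S) * G := by rw [← hbG.eq]; simp only [mul_assoc]
      _ = b * S * (S * (b * G)) := by rw [hGP, mul_one, ← hbS.eq, hbS.eq]; simp only [mul_assoc]
      _ = b * (S * (S * G)) * b := by rw [hbG.eq]; simp only [mul_assoc]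
      _ = _ := by rw [hSG.eq, ← mul_assoc S, hSG.eq]
  rw [hPb, h2, mul_add, add_mul, h1]
  calc G * S + b * (G * S * S) * b = G * S * (1 + b * S * b) := by
        rw [mul_add, mul_one, ← mul_assoc (G * S), ← mul_assoc (G * S), mul_assoc G S b, ← hbS.eq,
          ← mul_assoc G b S, ← hbG.eq]
        simp only [mul_assoc]
    _ = G * S * S + G * S * (b * (b ^ n * b ^ n) * b) := by rw [hrec, mul_add]
    _ = G * S * S + S * (G * b) * (b ^ n * b ^ n) * b := by rw [← hSG.eq]; simp only [mul_assoc]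
    _ = G * S * S + (S * b) * (G * (b ^ n * b ^ n)) * b := by
        rw [← hbG.eq]; simp only [mul_assoc]
    _ = b * S * b + G * S * S := by rw [hGP, mul_one, ← hbS.eq, add_comm]

theorem mul_inv_mul_sq {x y : K} (hxy : x * y = y * x) (hx0 : x ≠ 0) :
    x * (x⁻¹ * y * (x⁻¹ * y)) * x = y * y := by
  have e1 : x⁻¹ * y = y * x⁻¹ := (Commute.inv_left₀ hxy).eq
  calc _ = x * x⁻¹ * y * ((x⁻¹ * y) * x) := by simp only [mul_assoc]
    _ = y * y := by rw [e1, mul_inv_cancel₀ hx0, one_mul, inv_mul_cancel_right₀ hx0]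

end DivisionRing

section Geometric

variable {K : Type*} [DivisionRing K] [StarRing K] {C : SummationCone K} {b : K}

theorem not_geometric_of_inv (hb : star b = b) (hb0 : b ≠ 0) {s t : K}
    (hs : C.HasTotal (fun n => b ^ n * b ^ n) s)
    (ht : C.HasTotal (fun n => b⁻¹ ^ n * b⁻¹ ^ n) t) : False := by
  have h1 : C.HasTotal (fun n => (2 : K) + (b ^ n - b⁻¹ ^ n) * (b ^ n - b⁻¹ ^ n)) (s + t) := by
    refine total_congr (C.total_add hs ht) fun n => ?_
    have e1 : b ^ n * b⁻¹ ^ n = 1 := by rw [inv_pow]; exact mul_inv_cancel₀ (pow_ne_zero n hb0)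
    have e2 : b⁻¹ ^ n * b ^ n = 1 := by rw [inv_pow]; exact inv_mul_cancel₀ (pow_ne_zero n hb0)
    simp only [mul_sub, sub_mul, e1, e2]
    rw [← one_add_one_eq_two]
    abel
  have h2 : C.Pos (2 : K) := by simpa using C.natCast 2
  obtain ⟨t, u, -, ht, -⟩ := C.split (fun _ => h2)
    (fun n => C.mul_self (by simp [hb])) h1
  have := C.charZero
  exact two_ne_zero (eq_zero_of_const ht)

theorem geometric_eq (hb : star b = b) (hb0 : b ≠ 0) {N : K}
    (hN : C.HasTotal (fun n => b ^ n * b ^ n) N) : N - 1 = b * N * b := by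
  have h1 := C.tail hN
  have h2 := C.total_conj hb0 hN
  have h3 := C.unique h1 (total_congr h2 fun n => by
    rw [hb, ← mul_assoc, ← pow_succ', mul_assoc, ← pow_succ])
  simpa [hb] using h3

theorem geometric_commute (hb : star b = b) (hb0 : b ≠ 0) {N : K}
    (hN : C.HasTotal (fun n => b ^ n * b ^ n) N) : N * b = b * N := by
  have e := geometric_eq hb hb0 hN
  have hNs := C.star_eq (C.total_pos hN)
  by_contra hne
  set D := N * b - b * N with hD
  have hD0 : D ≠ 0 := sub_ne_zero.2 hne
  have hbDb : b * D * b = D := by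
    have : b * D * b = (b * N * b) * b - b * (b * N * b) := by rw [hD]; noncomm_ring
    rw [this, ← e, hD]
    noncomm_ring
  have hDs : star D = -D := by
    rw [hD, star_sub, star_mul, star_mul, hb, hNs]
    abel
  have hbD : b * D = D * b⁻¹ := by rw [eq_mul_inv_iff_mul_eq₀ hb0, hbDb]
  have hDb : D * b = b⁻¹ * D := by rw [eq_inv_mul_iff_mul_eq₀ hb0, ← mul_assoc, hbDb]
  set d := D * star D with hd
  have hdpos : C.Pos d := C.mul_star_self D
  have hdb : Commute b d := by
    change b * d = d * b
    rw [hd, hDs, mul_neg, mul_neg, neg_mul, ← mul_assoc, hbD, mul_assoc, ← hDb, mul_assoc]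
  have h1d : 1 + d ≠ 0 := one_add_ne_zero hdpos
  set g := (1 + d)⁻¹ with hg
  have hgb : Commute b g := ((Commute.one_right b).add_right hdb).inv_right₀
  have hgs : star g = g := by simp [hg, C.star_eq hdpos]
  have hQ : C.Pos (g * (1 + d + d * d) * g) := by
    have := C.conj g (C.add (C.add C.one hdpos) (C.mul_self (C.star_eq hdpos)))
    rwa [hgs] at this
  have hP : C.Pos (g * d * g) := by
    have := C.conj g hdpos
    rwa [hgs] at this
  have hsum : g * d * g + g * (1 + d + d * d) * g = 1 := by
    have : g * d * g + g * (1 + d + d * d) * g = (g * (1 + d)) * ((1 + d) * g) := by noncomm_ring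
    rw [this, hg, inv_mul_cancel₀ h1d, mul_inv_cancel₀ h1d, one_mul]
  have hpow (n : ℕ) : star (b ^ n) = b ^ n := by rw [star_pow, hb]
  have hc (n : ℕ) {a : K} (ha : C.Pos a) : C.Pos (b ^ n * a * b ^ n) := by
    have := C.conj (b ^ n) ha
    rwa [hpow] at this
  obtain ⟨t, u, -, ht, -⟩ := C.split (s := N) (fun n => hc n hP) (fun n => hc n hQ)
    (total_congr hN fun n => by rw [← add_mul, ← mul_add, hsum, mul_one])
  have hgD : g * D ≠ 0 := mul_ne_zero (inv_ne_zero h1d) hD0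
  have hbgD : SemiconjBy (g * D) b⁻¹ b := by
    change g * D * b⁻¹ = b * (g * D)
    rw [← mul_assoc, hgb.eq, mul_assoc, mul_assoc, hbD]
  have key (n : ℕ) : b ^ n * (g * d * g) * b ^ n = (g * D) * (b⁻¹ ^ n * b⁻¹ ^ n) * star (g * D) := by
    have e1 := (hbgD.pow_right n).eq
    have e2 := congrArg star e1
    rw [star_mul, star_mul (b ^ n), hpow, star_pow, star_inv₀, hb] at e2
    rw [← mul_assoc (g * D), e1, mul_assoc (b ^ n * (g * D)), e2, star_mul, hgs, hd]
    simp only [mul_assoc]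
  have ht2 := C.total_conj (inv_ne_zero hgD) (total_congr ht key)
  refine not_geometric_of_inv hb hb0 hN (total_congr ht2 fun n => ?_)
  have hgDs : star (g * D) ≠ 0 := star_ne_zero.2 hgD
  rw [star_inv₀, ← mul_assoc, ← mul_assoc, inv_mul_cancel₀ hgD, one_mul, mul_assoc,
    mul_inv_cancel₀ hgDs, mul_one]

theorem geometric_mul (hb : star b = b) (hb0 : b ≠ 0) {N : K}
    (hN : C.HasTotal (fun n => b ^ n * b ^ n) N) : N * (1 - b * b) = 1 := by
  have e := geometric_eq hb hb0 hN
  rw [← geometric_commute hb hb0 hN, mul_assoc] at e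
  rw [mul_sub, ← e]
  simp

theorem geometric_pos (hb : star b = b) (hb0 : b ≠ 0) {N : K}
    (hN : C.HasTotal (fun n => b ^ n * b ^ n) N) : C.Pos (1 - b * b) := by
  rw [← inv_eq_of_mul_eq_one_right (geometric_mul hb hb0 hN)]
  exact inv (C.total_pos hN)

theorem geometric_trichotomy (C : SummationCone K) (hb : star b = b) (hb0 : b ≠ 0) :
    (∃ N, C.HasTotal (fun n => b ^ n * b ^ n) N) ∨
      (∃ N, C.HasTotal (fun n => b⁻¹ ^ n * b⁻¹ ^ n) N) ∨ b * b = 1 := by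
  rcases C.geometric_or hb hb0 with h | h1
  · exact Or.inl h
  rcases C.geometric_or (b := b⁻¹) (by rw [star_inv₀, hb]) (inv_ne_zero hb0) with h | h2
  · exact Or.inr (Or.inl h)
  refine Or.inr (Or.inr ?_)
  simp only [inv_inv] at h2
  have h3 := C.unique h1 (total_congr (C.total_conj hb0 h2) fun n => ?_)
  · simpa [hb] using h3.symm
  · rw [geometric_inv_partial hb0, hb, mul_inv_rev, mul_inv_rev]
    simp only [← mul_assoc, mul_inv_cancel₀ hb0, one_mul]
    rw [mul_assoc, inv_mul_cancel₀ hb0, mul_one]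

theorem pos_sq_sub_sq {x y : K} (hx : star x = x) (hxy : x * y = y * x) (hx0 : x ≠ 0)
    (h : C.Pos (1 - (x⁻¹ * y) * (x⁻¹ * y))) : C.Pos (x * x - y * y) := by
  have h1 := C.conj x h
  rwa [hx, mul_sub, sub_mul, mul_one, mul_inv_mul_sq hxy hx0] at h1

theorem pos_or_neg (C : SummationCone K) {a : K} (ha : star a = a) : C.Pos a ∨ C.Pos (-a) := by
  have := C.charZero
  have hus : star (a + 1) = a + 1 := by simp [ha]
  have hvs : star (a - 1) = a - 1 := by simp [ha]
  have huv : (a + 1) * (a - 1) = (a - 1) * (a + 1) := by noncomm_ring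
  have quarter {x : K} (h : C.Pos ((4 : ℚ) * x)) : C.Pos x := by
    have := smul (q := 1 / 4) (by norm_num) h
    rwa [← mul_assoc, ← Rat.cast_mul, show (1 / 4 : ℚ) * 4 = 1 by norm_num, Rat.cast_one,
      one_mul] at this
  have e4 : (a + 1) * (a + 1) - (a - 1) * (a - 1) = (4 : ℚ) * a := by
    push_cast
    rw [show (4 : K) = 1 + 1 + 1 + 1 by norm_num]
    noncomm_ring
  have e4n : (a - 1) * (a - 1) - (a + 1) * (a + 1) = (4 : ℚ) * (-a) := by
    rw [mul_neg, ← e4, neg_sub]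
  rcases eq_or_ne (a + 1) 0 with h0 | hu0
  · refine Or.inr (quarter ?_)
    rw [← e4n, h0, mul_zero, sub_zero]
    exact C.mul_self hvs
  rcases eq_or_ne (a - 1) 0 with h0 | hv0
  · refine Or.inl (quarter ?_)
    rw [← e4, h0, mul_zero, sub_zero]
    exact C.mul_self hus
  have hcomm : (a + 1)⁻¹ * (a - 1) = (a - 1) * (a + 1)⁻¹ := (Commute.inv_left₀ huv).eq
  have hb : star ((a + 1)⁻¹ * (a - 1)) = (a + 1)⁻¹ * (a - 1) := by
    rw [star_mul, star_inv₀, hus, hvs, hcomm]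
  have hb0 := mul_ne_zero (inv_ne_zero hu0) hv0
  rcases geometric_trichotomy C hb hb0 with ⟨N, hN⟩ | ⟨N, hN⟩ | h
  · refine Or.inl (quarter ?_)
    rw [← e4]
    exact pos_sq_sub_sq hus huv hu0 (geometric_pos hb hb0 hN)
  · refine Or.inr (quarter ?_)
    rw [← e4n]
    have := geometric_pos (by rw [star_inv₀, hb]) (inv_ne_zero hb0) hN
    rw [mul_inv_rev, inv_inv] at this
    exact pos_sq_sub_sq hvs huv.symm hv0 this
  · refine Or.inl (quarter ?_)
    have : (a + 1) * (a + 1) - (a - 1) * (a - 1) = 0 := by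
      rw [← mul_inv_mul_sq huv hu0, h, mul_one, sub_self]
    rw [← e4, this]
    exact C.zero

theorem exists_geometric_four (C : SummationCone K) :
    ∃ N, C.HasTotal (fun n => (2 : K)⁻¹ ^ n * (2 : K)⁻¹ ^ n) N := by
  have := C.charZero
  have hs : star (2 : K) = 2 := star_ofNat 2
  rcases geometric_trichotomy C hs two_ne_zero with ⟨N, hN⟩ | h | h
  · have h1 := geometric_mul hs two_ne_zero hN
    have h3 := natCast_mul (C.total_pos hN) 3
    refine absurd ?_ (one_add_ne_zero h3)
    rw [← h1, (Nat.cast_commute 3 N).eq, ← mul_add]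
    norm_num
  · exact h
  · norm_num at h

end Geometric

end SummationCone

namespace SummationCone

section Order

variable {K : Type*} [DivisionRing K] [StarRing K] {C : SummationCone K}

theorem eq_zero_of_le_geometric {p : K} (hp : C.Pos p)
    (h : ∀ n : ℕ, C.Pos ((2 : K)⁻¹ ^ n * (2 : K)⁻¹ ^ n - p)) : p = 0 := by
  obtain ⟨N, hN⟩ := exists_geometric_four C
  obtain ⟨t, u, -, ht, -⟩ := C.split (fun _ => hp) h
    (total_congr hN fun n => (add_sub_cancel p _).symm)
  exact eq_zero_of_const ht

theorem exists_one_le_mul {a : K} (ha : C.Pos a) (ha0 : a ≠ 0) :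
    ∃ n : ℕ, C.Pos (n * a - 1) := by
  have := C.charZero
  by_contra! hne
  refine ha0 (eq_zero_of_le_geometric ha fun k => ?_)
  have h1 := (C.pos_or_neg (a := ((2 : K) ^ k * 2 ^ k) * a - 1) ?_).resolve_left
    (by simpa using hne (2 ^ k * 2 ^ k))
  · have h2 := C.conj ((2 : K)⁻¹ ^ k) h1
    convert h2 using 1
    have e1 : (2 : K)⁻¹ ^ k * 2 ^ k = 1 := by
      rw [inv_pow]; exact inv_mul_cancel₀ (pow_ne_zero k two_ne_zero)
    have e2 : (2 : K) ^ k * (2 : K)⁻¹ ^ k = 1 := by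
      rw [inv_pow]; exact mul_inv_cancel₀ (pow_ne_zero k two_ne_zero)
    have c1 : Commute a ((2 : K)⁻¹ ^ k) :=
      ((Nat.cast_commute 2 a).symm.inv_right₀.pow_right k)
    rw [star_pow, star_inv₀, star_ofNat, neg_sub, mul_sub, mul_one, sub_mul]
    congr 1
    rw [← mul_assoc, ← mul_assoc, e1, one_mul, mul_assoc, c1.eq, ← mul_assoc, e2, one_mul]
  · have c1 : Commute a ((2 : K) ^ k * 2 ^ k) := by
      have := (Nat.cast_commute 2 a).symm.pow_right k
      exact this.mul_right this
    simp only [star_sub, star_mul, star_pow, star_ofNat, star_one, C.star_eq ha]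
    rw [c1.eq]

theorem exists_le_natCast {a : K} (ha : C.Pos a) : ∃ n : ℕ, C.Pos (n - a) := by
  rcases eq_or_ne a 0 with rfl | ha0
  · exact ⟨0, by simpa using C.zero⟩
  obtain ⟨n, hn⟩ := exists_one_le_mul (inv ha) (inv_ne_zero ha0)
  refine ⟨n, ?_⟩
  have hs : star ((n : K) - a) = n - a := by simp [C.star_eq ha]
  have hc : (n : K) * a = a * n := Nat.cast_commute n a
  refine (C.pos_or_neg hs).elim id fun h => ?_
  have h1 := C.conj a hn
  have e1 : a * (n * a⁻¹ - 1) * star a = a * (n - a) := by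
    rw [C.star_eq ha, mul_sub, sub_mul, mul_sub, mul_one, ← mul_assoc, inv_mul_cancel_right₀ ha0]
  rw [e1] at h1
  have h2 : C.Pos (-(a * (n - a))) := by
    have := C.add (C.mul_self hs) (natCast_mul h n)
    convert this using 1
    simp only [mul_sub, sub_mul, mul_neg, hc]
    abel
  have h3 : (n : K) - a = 0 := by
    simpa [ha0] using eq_zero_of_neg h1 h2
  rw [h3]
  exact C.zero

variable (C)

/-- The order on the selfadjoint elements defined by the cone. -/
@[reducible] noncomputable def linearOrder : LinearOrder (selfAdjoint K) where
  le a b := C.Pos ((b : K) - a)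
  le_refl a := by simpa using C.zero
  le_trans a b c hab hbc := by simpa using C.add hbc hab
  le_antisymm a b hab hba := by
    have := eq_zero_of_neg hab (by simpa using hba)
    exact Subtype.ext (sub_eq_zero.1 this).symm
  le_total a b := by
    have := C.pos_or_neg (a := (b : K) - a) (selfAdjoint.mem_iff.1 (b - a).2)
    simpa using this
  toDecidableLE := Classical.decRel _

/-- The real part on `K` attached to a summation cone. -/
structure IsRealPart (C : SummationCone K) (τ : K →+ ℝ) : Prop where
  map_one : τ 1 = 1
  map_star : ∀ a, τ (star a) = τ a
  pos_iff : ∀ a, star a = a → (C.Pos a ↔ 0 ≤ τ a)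

theorem exists_isRealPart : ∃ τ : K →+ ℝ, IsRealPart C τ := by
  let _ := C.linearOrder
  have hle (a b : selfAdjoint K) : a ≤ b ↔ C.Pos ((b : K) - a) := Iff.rfl
  have : IsOrderedAddMonoid (selfAdjoint K) :=
    { add_le_add_left := fun a b hab c => by
        rw [hle] at hab ⊢
        simpa using hab }
  have h01 : (0 : selfAdjoint K) ≤ 1 := by simpa [hle] using C.one
  have : ZeroLEOneClass (selfAdjoint K) := ⟨h01⟩
  have : NeZero (1 : selfAdjoint K) := ⟨fun h => one_ne_zero (congrArg Subtype.val h : (1 : K) = 0)⟩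
  have : Archimedean (selfAdjoint K) := ⟨fun x y hy => by
    have hy' : C.Pos (y : K) := by simpa [hle] using hy.le
    have hy0 : (y : K) ≠ 0 := fun h => hy.ne' (Subtype.ext h)
    obtain ⟨n, hn⟩ := exists_one_le_mul hy' hy0
    have hn' : (1 : selfAdjoint K) ≤ n • y := by simpa [hle] using hn
    obtain ⟨m, hm⟩ : ∃ m : ℕ, x ≤ m • (1 : selfAdjoint K) := by
      rcases C.pos_or_neg (selfAdjoint.mem_iff.1 x.2) with h | h
      · obtain ⟨m, hm⟩ := exists_le_natCast h
        exact ⟨m, by simpa [hle] using hm⟩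
      · exact ⟨0, by simpa [hle] using h⟩
    exact ⟨m * n, hm.trans (by rw [mul_smul]; exact nsmul_le_nsmul_right hn' m)⟩⟩
  let f := Archimedean.embedReal (selfAdjoint K)
  have hf1 : f 1 = 1 := Archimedean.embedReal_one
  have hf : ∀ a : selfAdjoint K, C.Pos (a : K) ↔ 0 ≤ f a := fun a => by
    have h0 : C.Pos (a : K) ↔ 0 ≤ a := by simp [hle]
    rw [h0]
    refine ⟨fun h => by simpa using f.monotone' h, fun h => ?_⟩
    by_contra hlt
    have h1 := f.monotone' (not_le.1 hlt).le
    have h2 : f a = f 0 := le_antisymm (by simpa using h1) (by simpa using h)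
    exact hlt (Archimedean.embedReal_injective (selfAdjoint K) h2).ge
  have hadd (a : K) : star (a + star a) = a + star a := by rw [star_add, star_star, add_comm]
  let g : K →+ selfAdjoint K :=
    { toFun := fun a => ⟨a + star a, hadd a⟩
      map_zero' := by ext; simp
      map_add' := fun a b => by ext; simp only [star_add, AddSubgroup.coe_add]; abel }
  have hg {a : K} (ha : star a = a) : g a = ⟨a, ha⟩ + ⟨a, ha⟩ := by ext; simp [g, ha]
  refine ⟨(AddMonoidHom.mulLeft (2⁻¹ : ℝ)).comp (f.toAddMonoidHom.comp g), ?_, fun a => ?_,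
    fun a ha => ?_⟩
  · have : g 1 = 1 + 1 := hg (star_one K)
    simp [this, hf1]
    norm_num
  · have : g (star a) = g a := by ext; simp [g, add_comm]
    simp [this]
  · simp [hg ha, hf ⟨a, ha⟩, ← two_mul]

end Order

section RealPart

variable {K : Type*} [DivisionRing K] [StarRing K] {C : SummationCone K} {τ : K →+ ℝ}

namespace IsRealPart

theorem nonneg (h : C.IsRealPart τ) {a : K} (ha : C.Pos a) : 0 ≤ τ a :=
  (h.pos_iff a (C.star_eq ha)).1 ha

theorem eq_zero (h : C.IsRealPart τ) {a : K} (ha : star a = a) (h0 : τ a = 0) : a = 0 :=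
  eq_zero_of_neg ((h.pos_iff a ha).2 h0.ge)
    ((h.pos_iff (-a) (by rw [star_neg, ha])).2 (by rw [map_neg, h0, neg_zero]))

theorem ratCast_mul (_ : C.IsRealPart τ) (q : ℚ) (a : K) : τ (q * a) = q * τ a := by
  have := C.charZero
  have h1 := map_rat_smul τ q a
  rwa [Rat.smul_def, Rat.smul_def] at h1

theorem ratCast (h : C.IsRealPart τ) (q : ℚ) : τ q = q := by
  simpa [h.map_one] using h.ratCast_mul q 1

theorem sq (h : C.IsRealPart τ) {a : K} (ha : star a = a) : τ (a * a) = τ a * τ a := by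
  have := C.charZero
  have bound (q e : ℚ) (he : 0 < e) (hq : |τ a - q| ≤ e) :
      0 ≤ τ (a * a) - 2 * q * τ a + q * q ∧ τ (a * a) - 2 * q * τ a + q * q ≤ e * e := by
    have hc (q : ℚ) (x : K) : x * q = q * x := (Rat.cast_commute q x).eq.symm
    set b : K := a - q with hb
    have hbs : star b = b := by simp [hb, ha]
    have hτb : τ b = τ a - q := by rw [hb, map_sub, h.ratCast]
    have hbb : τ (b * b) = τ (a * a) - 2 * q * τ a + q * q := by
      have : b * b = a * a - (q : K) * a - (q : K) * a + ((q * q : ℚ) : K) := by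
        rw [hb, sub_mul, mul_sub, mul_sub, hc q a]
        push_cast
        abel
      rw [this, map_add, map_sub, map_sub, h.ratCast_mul, h.ratCast]
      push_cast
      ring
    rw [← hbb]
    refine ⟨h.nonneg (C.mul_self hbs), ?_⟩
    rw [← hτb, abs_le] at hq
    have hu : C.Pos ((e : K) + b) := (h.pos_iff _ (by simp [hbs])).2 (by
      rw [map_add, h.ratCast]; linarith)
    have hv : C.Pos ((e : K) - b) := (h.pos_iff _ (by simp [hbs])).2 (by
      rw [map_sub, h.ratCast]; linarith)
    have h1 := C.add (C.conj ((e : K) + b) hv) (C.conj ((e : K) - b) hu)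
    have h2 : ((e : K) + b) * (e - b) * star ((e : K) + b) +
        (e - b) * (e + b) * star ((e : K) - b) =
        ((2 * e : ℚ) : K) * (((e * e : ℚ) : K) - b * b) := by
      rw [C.star_eq hu, C.star_eq hv]
      push_cast
      rw [← one_add_one_eq_two]
      have hbe := hc e b
      have hbe2 : (e : K) * b * e = e * (e * b) := by rw [mul_assoc, hbe]
      have hbe3 : b * b * (e : K) = e * (b * b) := by rw [mul_assoc, hbe, ← mul_assoc, hbe, mul_assoc]
      simp only [mul_add, add_mul, mul_sub, sub_mul, hbe, hbe2, hbe3, mul_assoc, one_mul]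
      abel
    rw [h2] at h1
    have h3 := h.nonneg h1
    rw [h.ratCast_mul, map_sub, h.ratCast] at h3
    push_cast at h3
    have he' : (0 : ℝ) < 2 * e := by exact_mod_cast mul_pos two_pos he
    have := nonneg_of_mul_nonneg_right h3 he'
    linarith
  have key : ∀ e : ℚ, 0 < e → |τ (a * a) - τ a * τ a| ≤ e * e := fun e he => by
    have he' : (0 : ℝ) < e := by exact_mod_cast he
    obtain ⟨q, h1, h2⟩ := exists_rat_btwn (sub_lt_self (τ a) he')
    have hq : |τ a - q| ≤ e := abs_le.2 ⟨by linarith, by linarith⟩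
    obtain ⟨h3, h4⟩ := bound q e he hq
    have h5 : (τ a - q) * (τ a - q) ≤ e * e := by nlinarith
    have h6 := mul_self_nonneg (τ a - q)
    exact abs_le.2 ⟨by nlinarith, by nlinarith⟩
  by_contra hne
  have hpos : 0 < |τ (a * a) - τ a * τ a| := abs_pos.2 (sub_ne_zero.2 hne)
  obtain ⟨e, he0, he⟩ := exists_rat_btwn (lt_min hpos one_pos)
  have he0' : 0 < e := by exact_mod_cast he0
  have := key e he0'
  have h1 := he.trans_le (min_le_left _ _)
  have h2 := he.trans_le (min_le_right _ _)
  nlinarith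

theorem mul (h : C.IsRealPart τ) {a b : K} (ha : star a = a) (hb : star b = b) :
    τ (a * b) = τ a * τ b := by
  have h1 : τ (b * a) = τ (a * b) := by rw [← h.map_star, star_mul, ha, hb]
  have h2 := h.sq (a := a + b) (by simp [ha, hb])
  simp only [mul_add, add_mul, map_add, h1, h.sq ha, h.sq hb] at h2
  linarith

theorem mul_mul (h : C.IsRealPart τ) {a b : K} (ha : star a = a) (hb : star b = b) :
    τ (a * b * a) = τ a * τ a * τ b := by
  have haa : star (a * a) = a * a := by simp [ha]
  have h1 := h.mul ha (b := a * b + b * a) (by simp [ha, hb, add_comm])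
  have h2 := h.mul haa hb
  have h3 := h.mul ha hb
  have h4 := h.mul hb ha
  rw [h.sq ha] at h2
  simp only [mul_add, map_add, ← mul_assoc, h2, h3, h4] at h1
  linarith

theorem comm (h : C.IsRealPart τ) {a b : K} (ha : star a = a) (hb : star b = b) :
    a * b = b * a := by
  have hd : (a * b - b * a) * star (a * b - b * a) = 0 := by
    refine h.eq_zero (by simp) ?_
    have e : (a * b - b * a) * star (a * b - b * a) +
        (a * b + b * a) * (a * b + b * a) =
        a * (b * b) * a + a * (b * b) * a + (b * (a * a) * b + b * (a * a) * b) := by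
      simp only [star_sub, star_mul, ha, hb]
      noncomm_ring
    have e1 := congrArg τ e
    have hs : star (a * b + b * a) = a * b + b * a := by simp [ha, hb, add_comm]
    simp only [map_add] at e1
    rw [h.sq hs, map_add, h.mul_mul ha (by simp [hb]), h.mul_mul hb (by simp [ha]), h.sq ha,
      h.sq hb, h.mul ha hb, h.mul hb ha] at e1
    linarith
  rcases mul_eq_zero.1 hd with h0 | h0
  · exact sub_eq_zero.1 h0
  · exact sub_eq_zero.1 (star_eq_zero.1 h0)

theorem skew_comm (h : C.IsRealPart τ) {a k : K} (ha : star a = a) (hk : star k = -k) :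
    a * k = k * a := by
  rcases eq_or_ne k 0 with rfl | hk0
  · simp
  set c := a * k - k * a with hc
  have hcs : star c = c := by simp [hc, ha, hk]; abel
  have hks : star (k * k) = k * k := by simp [hk]
  have hkc : k * c = -(c * k) := by
    have := h.comm ha hks
    rw [eq_neg_iff_add_eq_zero]
    calc k * c + c * k = a * (k * k) - (k * k) * a := by rw [hc]; noncomm_ring
      _ = 0 := by rw [this, sub_self]
  have hkk := C.mul_star_self k
  have hkkpos : 0 < τ (k * star k) := lt_of_le_of_ne (h.nonneg hkk) fun h0 => by
    have := h.eq_zero (C.star_eq hkk) h0.symm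
    simp [hk0] at this
  have e : τ (k * c * star k) = -(τ c * τ (k * star k)) := by
    rw [hkc, neg_mul, mul_assoc, map_neg, h.mul hcs (C.star_eq hkk)]
  have hc0 : τ c = 0 := by
    rcases C.pos_or_neg hcs with h1 | h1
    · have h2 := h.nonneg (C.conj k h1)
      have h3 := h.nonneg h1
      rw [e] at h2
      nlinarith
    · have h2 := h.nonneg (C.conj k h1)
      have h3 := h.nonneg h1
      rw [mul_neg, neg_mul, map_neg, e] at h2
      rw [map_neg] at h3
      nlinarith
  exact sub_eq_zero.1 (h.eq_zero hcs hc0)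

theorem central (h : C.IsRealPart τ) {a : K} (ha : star a = a) (x : K) :
    a * x = x * a := by
  have := C.charZero
  have h1 := h.comm ha (b := x + star x) (by simp [add_comm])
  have h2 := h.skew_comm ha (k := x - star x) (by simp)
  have h3 : a * (x + x) = (x + x) * a := by
    simp only [mul_add, add_mul, mul_sub, sub_mul] at h1 h2 ⊢
    have := congrArg₂ (· + ·) h1 h2
    simpa [add_assoc, add_comm, add_left_comm] using this
  have h2a : a * 2 = 2 * a := (Nat.cast_commute 2 a).eq.symm
  rw [← two_mul, ← mul_assoc, h2a] at h3
  simpa [mul_assoc] using h3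

end IsRealPart

end RealPart

end SummationCone

namespace SummationCone

namespace IsRealPart

variable {K : Type*} [DivisionRing K] [StarRing K] {C : SummationCone K} {τ : K →+ ℝ}

theorem geometric_total (h : C.IsRealPart τ) {N : K}
    (hN : C.HasTotal (fun n => (2 : K)⁻¹ ^ n * (2 : K)⁻¹ ^ n) N) : τ N = 4 / 3 := by
  have := C.charZero
  have e := geometric_mul (by simp) (inv_ne_zero two_ne_zero) hN
  have e1 : (1 : K) - 2⁻¹ * 2⁻¹ = ((3 / 4 : ℚ) : K) := by
    have : (3 / 4 : ℚ) = 1 - 2⁻¹ * 2⁻¹ := by norm_num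
    rw [this]
    push_cast
    rfl
  rw [e1, ← (Rat.cast_commute _ N).eq] at e
  have e2 := congrArg τ e
  rw [h.ratCast_mul, h.map_one] at e2
  push_cast at e2
  linarith

theorem exists_of_mem_Ico (h : C.IsRealPart τ) {r : ℝ} (h0 : 0 ≤ r) (h1 : r < 1) :
    ∃ a, star a = a ∧ τ a = r := by
  have := C.charZero
  set x : ℕ → ℚ := fun n => ⌊r * 4 ^ n⌋ * (1 / 4) ^ n with hx
  have h4' (n : ℕ) : (4 : ℝ) ^ n * (1 / 4) ^ n = 1 := by rw [← mul_pow]; norm_num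
  have hi (n : ℕ) : (0 : ℝ) < (1 / 4) ^ n := by positivity
  have hxle (n : ℕ) : (x n : ℝ) ≤ r := by
    have := mul_le_mul_of_nonneg_right (Int.floor_le (r * 4 ^ n)) (hi n).le
    rw [mul_assoc, h4', mul_one] at this
    simpa [hx] using this
  have hxlt (n : ℕ) : r < x n + (1 / 4) ^ n := by
    have := mul_lt_mul_of_pos_right (Int.lt_floor_add_one (r * 4 ^ n)) (hi n)
    rw [mul_assoc, h4', mul_one, add_mul, one_mul] at this
    simpa [hx] using this
  have hmono (n : ℕ) : (x n : ℝ) ≤ x (n + 1) := by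
    have h5 : ⌊r * 4 ^ n⌋ * 4 ≤ ⌊r * 4 ^ (n + 1)⌋ := by
      rw [Int.le_floor]
      push_cast
      rw [pow_succ, ← mul_assoc]
      exact mul_le_mul_of_nonneg_right (Int.floor_le _) (by norm_num)
    have h6 : ((⌊r * 4 ^ n⌋ : ℝ)) * 4 ≤ ⌊r * 4 ^ (n + 1)⌋ := by exact_mod_cast h5
    have h7 := mul_le_mul_of_nonneg_right h6 (hi (n + 1)).le
    simp only [hx]
    push_cast
    refine le_trans (le_of_eq ?_) h7
    rw [pow_succ]
    ring
  have hx0 : x 0 = 0 := by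
    simp only [hx, pow_zero, mul_one, Int.cast_eq_zero]
    exact Int.floor_eq_zero_iff.2 ⟨h0, h1⟩
  obtain ⟨N, hN⟩ := exists_geometric_four C
  have hpow (n : ℕ) : (2 : K)⁻¹ ^ n * (2 : K)⁻¹ ^ n = (((1 / 4) ^ n : ℚ) : K) := by
    rw [show (1 / 4 : ℚ) = 2⁻¹ * 2⁻¹ by norm_num, mul_pow]
    push_cast
    rfl
  have hposrat {q : ℚ} (hq : (0 : ℝ) ≤ q) : C.Pos (q : K) :=
    (h.pos_iff _ (by simp)).2 (by rwa [h.ratCast])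
  have hsplit := C.split (s := N) (p := fun n => ((x (n + 1) - x n : ℚ) : K))
    (q := fun n => (((1 / 4) ^ n - (x (n + 1) - x n) : ℚ) : K))
    (fun n => hposrat (by push_cast; linarith [hmono n]))
    (fun n => hposrat (by push_cast; linarith [hxle (n + 1), hxlt n]))
    (total_congr hN fun n => by
      rw [hpow, ← Rat.cast_add]
      congr 1
      ring)
  obtain ⟨t, u, htu, ht, hu⟩ := hsplit
  have hts := C.star_eq (C.total_pos ht)
  refine ⟨t, hts, ?_⟩
  have hτ : τ t + τ u = 4 / 3 := by rw [← map_add, ← htu, h.geometric_total hN]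
  have ht1 (n : ℕ) : (x n : ℝ) ≤ τ t := by
    have h5 := h.nonneg (sub_sum ht n)
    rw [← Rat.cast_sum, Finset.sum_range_sub, map_sub, h.ratCast, hx0] at h5
    push_cast at h5
    linarith
  have hu1 (n : ℕ) : τ t ≤ x n + 4 / 3 * (1 / 4) ^ n := by
    have h5 := h.nonneg (sub_sum hu n)
    rw [← Rat.cast_sum, Finset.sum_sub_distrib, Finset.sum_range_sub, geom_sum_eq (by norm_num),
      map_sub, h.ratCast, hx0] at h5
    push_cast at h5
    rw [show (1 / 4 - 1 : ℝ) = -(3 / 4) by norm_num, div_neg] at h5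
    linarith
  have hlim : Filter.Tendsto (fun n : ℕ => 4 / 3 * (1 / 4 : ℝ) ^ n) Filter.atTop (nhds 0) := by
    simpa using (tendsto_pow_atTop_nhds_zero_of_lt_one (r := (1 / 4 : ℝ)) (by norm_num)
      (by norm_num)).const_mul (4 / 3)
  have habs : |τ t - r| ≤ 0 := ge_of_tendsto' hlim fun n => by
    rw [abs_le]
    have := hi n
    constructor <;> linarith [hxle n, hxlt n, ht1 n, hu1 n]
  linarith [abs_nonpos_iff.1 habs]

theorem exists_eq (h : C.IsRealPart τ) (r : ℝ) : ∃ a, star a = a ∧ τ a = r := by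
  obtain ⟨a, ha, har⟩ := h.exists_of_mem_Ico (Int.fract_nonneg r) (Int.fract_lt_one r)
  refine ⟨a + ((⌊r⌋ : ℚ) : K), by simp [ha], ?_⟩
  rw [map_add, h.ratCast, har]
  push_cast
  exact Int.fract_add_floor r

/-- The real numbers are the selfadjoint elements, which are central. -/
theorem exists_ringHom (h : C.IsRealPart τ) : ∃ ι : ℝ →+* K, (∀ r, star (ι r) = ι r) ∧
    (∀ r x, ι r * x = x * ι r) ∧ (∀ a, star a = a → ∃ r, ι r = a) ∧
    ∀ x, ∃ r, 0 ≤ r ∧ x * star x = ι r := by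
  choose g hgs hg using h.exists_eq
  have hinj {a b : K} (ha : star a = a) (hb : star b = b) (hab : τ a = τ b) : a = b :=
    sub_eq_zero.1 (h.eq_zero (by simp [ha, hb]) (by rw [map_sub, hab, sub_self]))
  have hgτ {a : K} (ha : star a = a) : g (τ a) = a := hinj (hgs _) ha (hg _)
  refine ⟨⟨⟨⟨g, ?_⟩, fun r s => ?_⟩, ?_, fun r s => ?_⟩, hgs, fun r => h.central (hgs r),
    fun a ha => ⟨τ a, hgτ ha⟩, fun x => ⟨τ (x * star x), h.nonneg (C.mul_star_self x),
      (hgτ (by simp)).symm⟩⟩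
  · simpa [h.map_one] using hgτ (star_one K)
  · refine hinj (hgs _) ?_ ?_
    · simp [hgs, h.comm (hgs s) (hgs r)]
    · simp [hg, h.mul (hgs r) (hgs s)]
  · simpa using hgτ (star_zero K)
  · exact hinj (hgs _) (by simp [hgs]) (by simp [hg])

end IsRealPart

end SummationCone

section Frobenius

variable {K : Type*} [DivisionRing K] [StarRing K] [Algebra ℝ K]

theorem RingEquiv.symm_apply_star {R K : Type*} [NonUnitalNonAssocSemiring R] [Star R]
    [NonUnitalNonAssocSemiring K] [Star K] (e : R ≃+* K) (he : ∀ z, star (e z) = e (star z))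
    (ρ : K) : e.symm (star ρ) = star (e.symm ρ) := by
  obtain ⟨z, rfl⟩ := e.surjective ρ
  rw [he, e.symm_apply_apply, e.symm_apply_apply]

/-- The selfadjoint elements of `K` are the real numbers, and norms are nonnegative. -/
structure RealSelfAdjoint (K : Type*) [DivisionRing K] [StarRing K] [Algebra ℝ K] : Prop where
  star_algebraMap : ∀ r : ℝ, star (algebraMap ℝ K r) = algebraMap ℝ K r
  exists_eq : ∀ a : K, star a = a → ∃ r : ℝ, a = r • (1 : K)
  mul_star : ∀ a : K, ∃ r : ℝ, 0 ≤ r ∧ a * star a = r • (1 : K)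

namespace RealSelfAdjoint

theorem star_smul (h : RealSelfAdjoint K) (r : ℝ) (x : K) : star (r • x) = r • star x := by
  rw [Algebra.smul_def, star_mul, h.star_algebraMap, ← Algebra.commutes, Algebra.smul_def]

theorem exists_smul_mul_self (h : RealSelfAdjoint K) {k : K} (hk : star k = -k) (hk0 : k ≠ 0) :
    ∃ c : ℝ, (c • k) * (c • k) = -1 := by
  obtain ⟨r, hr, hkr⟩ := h.mul_star k
  have hr0 : r ≠ 0 := by
    rintro rfl
    simp [hk, hk0] at hkr
  refine ⟨(√r)⁻¹, ?_⟩
  rw [hk, mul_neg, neg_eq_iff_eq_neg] at hkr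
  have : (√r)⁻¹ * (√r)⁻¹ * r = 1 := by
    rw [← mul_inv, Real.mul_self_sqrt hr, inv_mul_cancel₀ hr0]
  rw [smul_mul_smul_comm, hkr, smul_neg, smul_smul, this, one_smul]

theorem exists_add_skew (h : RealSelfAdjoint K) (x : K) :
    ∃ (r : ℝ) (k : K), star k = -k ∧ x = r • (1 : K) + k := by
  obtain ⟨r, hr⟩ := h.exists_eq ((2⁻¹ : ℝ) • (x + star x)) (by
    rw [h.star_smul, star_add, star_star, add_comm])
  refine ⟨r, (2⁻¹ : ℝ) • (x - star x), ?_, ?_⟩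
  · rw [h.star_smul, star_sub, star_star, ← smul_neg, neg_sub]
  · rw [← hr]
    module

theorem exists_anticommute (h : RealSelfAdjoint K) {u m : K} (hu : star u = -u)
    (huu : u * u = -1) (hm : star m = -m) :
    ∃ r : ℝ, u * (m + r • u) + (m + r • u) * u = 0 := by
  obtain ⟨r, hr⟩ := h.exists_eq (u * m + m * u) (by simp [hu, hm, add_comm])
  refine ⟨r / 2, ?_⟩
  calc _ = (u * m + m * u) + r • (u * u) := by
        simp only [mul_add, add_mul, mul_smul_comm, smul_mul_assoc]
        module
    _ = 0 := by rw [hr, huu, smul_neg, add_neg_cancel]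

theorem exists_realEquiv (h : RealSelfAdjoint K) (hk : ∀ k : K, star k = -k → k = 0) :
    ∃ φ : K ≃+* ℝ, ∀ ρ : K, φ (star ρ) = φ ρ := by
  have hsurj : Function.Surjective (algebraMap ℝ K) := fun x => by
    obtain ⟨r, k, hks, rfl⟩ := h.exists_add_skew x
    exact ⟨r, by rw [hk k hks, add_zero, Algebra.algebraMap_eq_smul_one]⟩
  refine ⟨(RingEquiv.ofBijective (algebraMap ℝ K) ⟨(algebraMap ℝ K).injective, hsurj⟩).symm,
    fun ρ => ?_⟩
  obtain ⟨r, rfl⟩ := hsurj ρ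
  rw [h.star_algebraMap]

theorem exists_complexEquiv (h : RealSelfAdjoint K) {i : K} (hi : star i = -i) (hii : i * i = -1)
    (hk : ∀ k : K, star k = -k → ∃ r : ℝ, k = r • i) :
    ∃ φ : K ≃+* ℂ, ∀ ρ : K, φ (star ρ) = star (φ ρ) := by
  let f := Complex.liftAux i hii
  have hf (z : ℂ) : f z = z.re • (1 : K) + z.im • i := by
    rw [Complex.liftAux_apply, Algebra.algebraMap_eq_smul_one]
  have hsurj : Function.Surjective f.toRingHom := fun x => by
    obtain ⟨r, k, hks, rfl⟩ := h.exists_add_skew x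
    obtain ⟨s, rfl⟩ := hk k hks
    exact ⟨⟨r, s⟩, hf _⟩
  refine ⟨(RingEquiv.ofBijective f.toRingHom ⟨f.toRingHom.injective, hsurj⟩).symm,
    RingEquiv.symm_apply_star _ fun z => ?_⟩
  change star (f z) = f (star z)
  simp [hf, h.star_smul, hi]

theorem exists_quaternionEquiv (h : RealSelfAdjoint K) {i j : K} (hi : star i = -i)
    (hii : i * i = -1)
    (hj : star j = -j) (hjj : j * j = -1) (hij : i * j + j * i = 0) :
    ∃ φ : K ≃+* Quaternion ℝ, ∀ ρ : K, φ (star ρ) = star (φ ρ) := by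
  have hji : j * i = -(i * j) := by rw [eq_neg_iff_add_eq_zero, add_comm, hij]
  let q : QuaternionAlgebra.Basis K (-1 : ℝ) 0 (-1) :=
    { i := i
      j := j
      k := i * j
      i_mul_i := by simp [hii]
      j_mul_j := by simp [hjj]
      i_mul_j := rfl
      j_mul_i := by simp [hji] }
  let f : Quaternion ℝ →ₐ[ℝ] K := q.liftHom
  have hf (z : Quaternion ℝ) :
      f z = z.re • (1 : K) + z.imI • i + z.imJ • j + z.imK • (i * j) := by
    rw [← Algebra.algebraMap_eq_smul_one]
    rfl
  have hkstar : star (i * j) = -(i * j) := by rw [star_mul, hi, hj, neg_mul_neg, hji]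
  have hk_sq : (i * j) * (i * j) = -1 := by
    rw [mul_assoc, ← mul_assoc j, hji, neg_mul, mul_assoc i j, hjj, mul_neg, mul_neg, mul_neg,
      mul_one, neg_neg, hii]
  have hskew (m : K) (hm : star m = -m) : ∃ a b c : ℝ, m = a • i + b • j + c • (i * j) := by
    have skew {m u : K} (r : ℝ) (hm : star m = -m) (hu : star u = -u) :
        star (m + r • u) = -(m + r • u) := by
      rw [star_add, h.star_smul, hm, hu, smul_neg, neg_add]
    have anti {u m v : K} (r : ℝ) (hum : u * m + m * u = 0) (huv : u * v + v * u = 0) :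
        u * (m + r • v) + (m + r • v) * u = 0 := by
      calc _ = (u * m + m * u) + r • (u * v + v * u) := by
            simp only [mul_add, add_mul, mul_smul_comm, smul_mul_assoc]
            module
        _ = 0 := by rw [hum, huv, smul_zero, add_zero]
    have hik : i * (i * j) + (i * j) * i = 0 := by
      rw [mul_assoc i j, hji, mul_neg, add_neg_cancel]
    have hjk : j * (i * j) + (i * j) * j = 0 := by
      rw [← mul_assoc, hji, neg_mul, neg_add_cancel]
    obtain ⟨a, ha⟩ := h.exists_anticommute hi hii hm
    obtain ⟨b, hb⟩ := h.exists_anticommute hj hjj (skew a hm hi)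
    obtain ⟨c, hc⟩ := h.exists_anticommute hkstar hk_sq (skew b (skew a hm hi) hj)
    have hia := anti c (anti b ha hij) hik
    have hja := anti c hb hjk
    generalize hw : m + a • i + b • j + c • (i * j) = w at hc hia hja
    have hcomm : i * j * w = w * (i * j) := by
      rw [mul_assoc, eq_neg_of_add_eq_zero_left hja, mul_neg, ← mul_assoc,
        eq_neg_of_add_eq_zero_left hia, neg_mul, neg_neg, mul_assoc]
    have h2 : (2 : ℝ) • (w * (i * j)) = 0 := by rw [two_smul, ← hc, hcomm]
    have hk0 : i * j ≠ 0 := fun h0 => by simp [h0] at hk_sq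
    have hw0 : w = 0 := by simpa [hk0] using h2
    refine ⟨-a, -b, -c, ?_⟩
    rw [hw0] at hw
    rw [← sub_eq_zero, ← hw]
    module
  have hsurj : Function.Surjective f.toRingHom := fun x => by
    obtain ⟨r, k, hks, rfl⟩ := h.exists_add_skew x
    obtain ⟨a, b, c, rfl⟩ := hskew k hks
    exact ⟨⟨r, a, b, c⟩, (hf _).trans (by simp only [add_assoc])⟩
  refine ⟨(RingEquiv.ofBijective f.toRingHom ⟨f.toRingHom.injective, hsurj⟩).symm,
    RingEquiv.symm_apply_star _ fun z => ?_⟩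
  change star (f z) = f (star z)
  simp [hf, h.star_smul, hi, hj, hji]

theorem classification (h : RealSelfAdjoint K) :
    (∃ φ : K ≃+* ℝ, ∀ ρ : K, φ (star ρ) = φ ρ) ∨
    (∃ φ : K ≃+* ℂ, ∀ ρ : K, φ (star ρ) = star (φ ρ)) ∨
    (∃ φ : K ≃+* Quaternion ℝ, ∀ ρ : K, φ (star ρ) = star (φ ρ)) := by
  by_cases hR : ∀ k : K, star k = -k → k = 0
  · exact Or.inl (h.exists_realEquiv hR)
  push Not at hR
  obtain ⟨k, hk, hk0⟩ := hR
  obtain ⟨c, hc⟩ := h.exists_smul_mul_self hk hk0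
  have hi : star (c • k) = -(c • k) := by rw [h.star_smul, hk, smul_neg]
  generalize c • k = i at hc hi
  by_cases hC : ∀ l : K, star l = -l → ∃ r : ℝ, l = r • i
  · exact Or.inr (Or.inl (h.exists_complexEquiv hi hc hC))
  push Not at hC
  obtain ⟨l, hl, hl0⟩ := hC
  obtain ⟨r, hr⟩ := h.exists_anticommute hi hc hl
  have hj : star (l + r • i) = -(l + r • i) := by
    rw [star_add, h.star_smul, hi, hl, smul_neg, neg_add]
  obtain ⟨d, hd⟩ := h.exists_smul_mul_self hj fun h0 => hl0 (-r) (by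
    rw [neg_smul, ← eq_neg_iff_add_eq_zero.2 h0])
  refine Or.inr (Or.inr (h.exists_quaternionEquiv hi hc
    (j := d • (l + r • i)) (by rw [h.star_smul, hj, smul_neg]) hd ?_))
  rw [mul_smul_comm, smul_mul_assoc, ← smul_add, hr, smul_zero]

end RealSelfAdjoint

end Frobenius

/-- **Solèr's Theorem** (field identification): an orthomodular Hermitian form
with an infinite orthonormal sequence forces the coordinate `*`-field to be
`ℝ` (identity involution), `ℂ` (conjugation), or `ℍ` (quaternionic conjugation). -/
theorem soler_field {K E : Type*} [DivisionRing K] [AddCommGroup E] [Module K E]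
    (h : HermitianSpace K E) (hom : h.Orthomodular) (e : ℕ → E)
    (horth : ∀ i j : ℕ, i ≠ j → h.form (e i) (e j) = 0)
    (hnorm : ∀ i : ℕ, h.form (e i) (e i) = 1) :
    (∃ φ : K ≃+* ℝ, ∀ ρ : K, φ (h.star ρ) = φ ρ) ∨
    (∃ φ : K ≃+* ℂ, ∀ ρ : K, φ (h.star ρ) = star (φ ρ)) ∨
    (∃ φ : K ≃+* Quaternion ℝ, ∀ ρ : K, φ (h.star ρ) = star (φ ρ)) := by
  let _ := h.starRing
  obtain ⟨τ, hτ⟩ := (hom.isSlotSystem horth hnorm).cone.exists_isRealPart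
  obtain ⟨ι, hι, hcentral, hsa, hnn⟩ := hτ.exists_ringHom
  let _ : Algebra ℝ K := ι.toAlgebra' hcentral
  have hone (r : ℝ) : r • (1 : K) = ι r := (Algebra.algebraMap_eq_smul_one r).symm
  have hK : RealSelfAdjoint K :=
    { star_algebraMap := hι
      exists_eq := fun a ha => (hsa a ha).imp fun r hr => by rw [hone, hr]
      mul_star := fun a => (hnn a).imp fun r hr => by rwa [hone] }
  exact hK.classification
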